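/- arXiv:2101.09803 — 5 statements merged into one kernel-verified Lean document; each statement's English description precedes it below -/
import Mathlib

section
/- Let S be a standard graded polynomial ring over a field k with dim S = d, let I ⊆ S be a graded ideal, R = S/I, and set 𝔞_i = Ann_S Ext^i_S(R, S) for each 0 ≤ i ≤ d. Then the product 𝔞₀ 𝔞₁ ⋯ 𝔞_d is contained in I. -/
open CategoryTheory MvPolynomial

/-- linear algebra core -/
theorem core {S : Type} [CommRing S] (r : ℕ → ℕ)
    (d : ∀ n, (Fin (r (n+1)) → S) →ₗ[S] (Fin (r n) → S))
    (hex : ∀ n v, d n (d (n+1) v) = 0)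
    (x : ℕ → S)
    (h0 : ∀ f : (Fin (r 0) → S) →ₗ[S] S, f ∘ₗ d 0 = 0 → x 0 • f = 0)
    (hs : ∀ i, ∀ f : (Fin (r (i+1)) → S) →ₗ[S] S, f ∘ₗ d (i+1) = 0 →
      ∃ g : (Fin (r i) → S) →ₗ[S] S, g ∘ₗ d i = x (i+1) • f)
    (D : ℕ) (hD : ∃ φ : (Fin (r D) → S) →ₗ[S] (Fin (r D) → S), φ ∘ₗ d D = 0 ∧
      ∀ v, φ v - v ∈ LinearMap.range (d D)) (v : Fin (r 0) → S) :
    (∏ i ∈ Finset.range (D+1), x i) • v ∈ LinearMap.range (d 0) := by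
  have key : ∀ n j, j + n = D → ∃ φ : (Fin (r j) → S) →ₗ[S] (Fin (r j) → S), φ ∘ₗ d j = 0 ∧
      ∀ v, φ v - (∏ i ∈ Finset.range n, x (j + 1 + i)) • v ∈ LinearMap.range (d j) := by
    intro n
    induction n with
    | zero =>
      rintro j rfl
      simpa using hD
    | succ n ih =>
      intro j hj
      obtain ⟨φ, h1, h2⟩ := ih (j+1) (by omega)
      have : ∀ c, ∃ g : (Fin (r j) → S) →ₗ[S] S, g ∘ₗ d j =
          x (j+1) • (LinearMap.proj c ∘ₗ φ) := fun c =>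
        hs j _ (by rw [LinearMap.comp_assoc, h1, LinearMap.comp_zero])
      choose g hg using this
      let h : (Fin (r j) → S) →ₗ[S] (Fin (r (j+1)) → S) := LinearMap.pi g
      have hh : ∀ v, h (d j v) = x (j+1) • φ v := by
        intro v
        ext c
        exact LinearMap.congr_fun (hg c) v
      refine ⟨(∏ i ∈ Finset.range (n+1), x (j + 1 + i)) • LinearMap.id - d j ∘ₗ h, ?_, ?_⟩
      · apply LinearMap.ext
        intro v
        obtain ⟨w, hw⟩ := h2 v
        have h3 : d j (φ v) = (∏ i ∈ Finset.range n, x (j + 1 + 1 + i)) • d j v := by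
          have := hex j w
          rw [hw, map_sub, map_smul, sub_eq_zero] at this
          exact this
        simp only [LinearMap.comp_apply, LinearMap.sub_apply, LinearMap.smul_apply,
          LinearMap.id_apply, hh, map_smul, h3, LinearMap.zero_apply]
        have h4 : ∏ i ∈ Finset.range (n+1), x (j + 1 + i) =
            x (j + 1) * ∏ i ∈ Finset.range n, x (j + 1 + 1 + i) := by
          rw [Finset.prod_range_succ', mul_comm]
          congr 1
          refine Finset.prod_congr rfl fun i _ => ?_
          rw [show j + 1 + 1 + i = j + 1 + (i + 1) by omega]
        rw [h4, smul_smul, sub_self]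
      · intro v
        exact ⟨- h v, by simp⟩
  obtain ⟨φ, h1, h2⟩ := key D 0 (by simp)
  have h3 : x 0 • φ v = 0 := by
    ext c
    exact LinearMap.congr_fun (h0 (LinearMap.proj c ∘ₗ φ)
      (by rw [LinearMap.comp_assoc, h1, LinearMap.comp_zero])) v
  obtain ⟨w, hw⟩ := h2 v
  refine ⟨- x 0 • w, ?_⟩
  rw [map_smul, hw, Finset.prod_range_succ', smul_sub, neg_smul, h3, smul_smul]
  simp only [zero_add, neg_zero, neg_mul, neg_smul, zero_sub, neg_neg, mul_comm, add_comm]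

theorem ann_homology {S : Type} [CommRing S] (T : ShortComplex (ModuleCat.{0} S)) (x : S)
    (hx : x ∈ Module.annihilator S T.homology) (z : T.X₂) (hz : T.g z = 0) :
    ∃ w, T.f w = x • z := by
  rw [T.moduleCatHomologyIso.toLinearEquiv.annihilator_eq, Module.mem_annihilator] at hx
  have := hx (Submodule.Quotient.mk ⟨z, hz⟩)
  obtain ⟨w, hw⟩ := (Submodule.Quotient.mk_eq_zero _).1 this
  exact ⟨w, congrArg Subtype.val hw⟩

section
open TensorProduct

theorem baseChange_pd {A B : Type} [CommRing A] [CommRing B] [Algebra A B] [Module.Flat A B]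
    (n : ℕ) : ∀ (M : Type) [AddCommGroup M] [Module A M],
    HasProjectiveDimensionLT (ModuleCat.of A M) (n + 1) →
    HasProjectiveDimensionLT (ModuleCat.of B (B ⊗[A] M)) (n + 1) := by
  induction n with
  | zero =>
    intro M _ _ h
    rw [zero_add, ← projective_iff_hasProjectiveDimensionLT_one,
      ← IsProjective.iff_projective] at h ⊢
    infer_instance
  | succ n ih =>
    intro M _ _ h
    let f : (M →₀ A) →ₗ[A] M := Finsupp.linearCombination A id
    have hf : Function.Surjective f := fun m => ⟨Finsupp.single m 1, by simp [f]⟩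
    have h1 := LinearMap.shortExact_shortComplexKer hf
    have h2 : Projective (ModuleCat.of A (M →₀ A)) := by
      rw [← IsProjective.iff_projective]; infer_instance
    have h3 := ih (LinearMap.ker f) ((h1.hasProjectiveDimensionLT_X₃_iff n h2).1 h)
    let T := ModuleCat.shortComplexOfCompEqZero ((LinearMap.ker f).subtype.baseChange B)
      (f.baseChange B) (by
        rw [← LinearMap.baseChange_comp]
        have : f ∘ₗ (LinearMap.ker f).subtype = 0 := by ext x; simp
        rw [this, LinearMap.baseChange_zero])
    have hT : T.ShortExact := by
      apply ModuleCat.shortComplex_shortExact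
      · have hex := LinearMap.exact_subtype_ker_map f
        exact Module.Flat.lTensor_exact (R := A) (N := LinearMap.ker f) (N' := M →₀ A) (N'' := M) B
          hex
      · exact Module.Flat.lTensor_preserves_injective_linearMap (M := B) _
          (LinearMap.ker f).injective_subtype
      · exact LinearMap.lTensor_surjective B hf
    have h4 : Projective T.X₂ := by
      change Projective (ModuleCat.of B (B ⊗[A] (M →₀ A)))
      rw [← IsProjective.iff_projective]; infer_instance
    exact (hT.hasProjectiveDimensionLT_X₃_iff n h4).2 h3

section
variable {A B : Type} [CommRing A] [CommRing B] [Algebra A B] (b : Module.Basis ℕ A B) (x : B)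
    (N : Type) [AddCommGroup N] [Module A N] [Module B N]
    [IsScalarTower A B N]

/-- evaluation -/
noncomputable def evN : B ⊗[A] N →ₗ[B] N :=
  TensorProduct.AlgebraTensorModule.lift ((LinearMap.lsmul B N).flip.restrictScalars A).flip

/-- multiplication by x as an A-linear map -/
noncomputable def mulN : N →ₗ[A] N := (LinearMap.lsmul B N x).restrictScalars A

/-- the Koszul map -/
noncomputable def delN : B ⊗[A] N →ₗ[B] B ⊗[A] N :=
  x • LinearMap.id - (mulN x N).baseChange B

/-- contracting homotopy -/
noncomputable def secN : B ⊗[A] N →ₗ[A] B ⊗[A] N :=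
  TensorProduct.lift (b.constr ℕ fun k => ∑ i ∈ Finset.range k,
    (TensorProduct.mk A B N (x ^ i)) ∘ₗ (mulN x N) ^ (k - 1 - i))

@[simp] theorem evN_tmul (y : B) (n : N) : evN (A := A) N (y ⊗ₜ n) = y • n := rfl

@[simp] theorem mulN_apply (n : N) : mulN (A := A) x N n = x • n := rfl

@[simp] theorem delN_tmul (y : B) (n : N) :
    delN (A := A) x N (y ⊗ₜ n) = (x * y) ⊗ₜ n - y ⊗ₜ (x • n) := by
  simp [delN, TensorProduct.smul_tmul']

theorem secN_zero (hb : ∀ k, b k = x ^ k) (n : N) : secN b x N ((x ^ 0) ⊗ₜ[A] n) = 0 := by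
  rw [← hb, secN, TensorProduct.lift.tmul, Module.Basis.constr_basis]
  simp

theorem secN_succ (hb : ∀ k, b k = x ^ k) (k : ℕ) (n : N) : secN b x N ((x ^ (k + 1)) ⊗ₜ[A] n) =
    (x ^ k) ⊗ₜ n + secN b x N ((x ^ k) ⊗ₜ[A] (x • n)) := by
  rw [← hb, ← hb k, secN, TensorProduct.lift.tmul, Module.Basis.constr_basis,
    TensorProduct.lift.tmul, Module.Basis.constr_basis, Finset.sum_range_succ, hb]
  simp only [LinearMap.add_apply, LinearMap.sum_apply, LinearMap.comp_apply]
  rw [add_comm]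
  congr 1
  · simp
  · refine Finset.sum_congr rfl fun i hi => ?_
    have hi := Finset.mem_range.1 hi
    obtain ⟨j, rfl⟩ : ∃ j, k = i + 1 + j := ⟨k - (i+1), by omega⟩
    have e1 : i + 1 + j + 1 - 1 - i = j + 1 := by omega
    have e2 : i + 1 + j - 1 - i = j := by omega
    rw [e1, e2, pow_succ]
    rfl

theorem ext_pow (hb : ∀ k, b k = x ^ k) {P : Type} [AddCommGroup P] [Module A P] (f g : B ⊗[A] N →ₗ[A] P)
    (h : ∀ k n, f ((x ^ k) ⊗ₜ n) = g ((x ^ k) ⊗ₜ n)) : f = g := by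
  apply TensorProduct.ext
  refine b.ext fun k => ?_
  ext n
  simpa [hb] using h k n

theorem sec_del (hb : ∀ k, b k = x ^ k) (p : B ⊗[A] N) : secN b x N (delN x N p) = p := by
  have : secN b x N ∘ₗ (delN x N).restrictScalars A = LinearMap.id := by
    apply ext_pow b x _ hb
    intro k n
    simp [← pow_succ', secN_succ b x _ hb]
  exact LinearMap.congr_fun this p

theorem del_sec (hb : ∀ k, b k = x ^ k) (p : B ⊗[A] N) : delN x N (secN b x N p) = p - 1 ⊗ₜ (evN N p) := by
  have : (delN x N).restrictScalars A ∘ₗ secN b x N = LinearMap.id -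
      TensorProduct.mk A B N 1 ∘ₗ (evN N).restrictScalars A := by
    apply ext_pow b x _ hb
    intro k
    induction k with
    | zero =>
      intro n
      rw [LinearMap.comp_apply, secN_zero b x _ hb, map_zero]
      simp
    | succ k ih =>
      intro n
      have := ih (x • n)
      simp only [LinearMap.comp_apply, LinearMap.restrictScalars_apply, LinearMap.sub_apply,
        LinearMap.id_apply, TensorProduct.mk_apply, evN_tmul] at this ⊢
      rw [secN_succ b x _ hb, map_add, this, delN_tmul, smul_smul, ← pow_succ, ← pow_succ']
      abel
  exact LinearMap.congr_fun this p

theorem poly_pd_aux (hb : ∀ k, b k = x ^ k) (n : ℕ) (h : HasProjectiveDimensionLT (ModuleCat.of A N) (n + 1)) :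
    HasProjectiveDimensionLT (ModuleCat.of B N) (n + 2) := by
  have : Module.Free A B := Module.Free.of_basis b
  have h1 := baseChange_pd (B := B) n N h
  have h0 : evN (A := A) N ∘ₗ delN x N = 0 := by
    have : ((evN (A := A) N ∘ₗ delN x N).restrictScalars A) = 0 := by
      apply ext_pow b x _ hb
      intro k n
      simp [smul_smul, mul_comm]
    exact LinearMap.ext fun v => LinearMap.congr_fun this v
  let T := ModuleCat.shortComplexOfCompEqZero (delN (A := A) x N) (evN N) h0
  have hT : T.ShortExact := by
    apply ModuleCat.shortComplex_shortExact
    · change Function.Exact (delN (A := A) x N) (evN (A := A) N)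
      intro v
      constructor
      · intro hv
        refine ⟨secN b x N v, ?_⟩
        rw [del_sec b x _ hb, hv]
        simp
      · rintro ⟨w, rfl⟩
        exact LinearMap.congr_fun h0 w
    · exact Function.LeftInverse.injective (sec_del b x N hb)
    · intro m
      exact ⟨1 ⊗ₜ m, by change evN (A := A) N (1 ⊗ₜ m) = m; simp⟩
  exact hT.hasProjectiveDimensionLT_X₃ (n + 1) h1
    (hasProjectiveDimensionLT_of_ge _ (n + 1) _ (by omega))
end

theorem poly_pd {A B : Type} [CommRing A] [CommRing B] [Algebra A B] (b : Module.Basis ℕ A B)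
    (x : B) (hb : ∀ k, b k = x ^ k) (n : ℕ)
    (h : ∀ M : ModuleCat.{0} A, HasProjectiveDimensionLT M (n + 1)) (N : ModuleCat.{0} B) :
    HasProjectiveDimensionLT N (n + 2) := by
  let : Module A N := Module.compHom N (algebraMap A B)
  have : IsScalarTower A B N := ⟨fun a y m => by
    rw [Algebra.smul_def, mul_smul]; rfl⟩
  exact poly_pd_aux b x N hb n (h _)

theorem base_proj {k : Type} [Field k] (M : ModuleCat.{0} (MvPolynomial (Fin 0) k)) :
    HasProjectiveDimensionLT M 1 := by
  have : IsSemisimpleRing (MvPolynomial (Fin 0) k) :=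
    (MvPolynomial.isEmptyRingEquiv k (Fin 0)).symm.isSemisimpleRing
  rw [← projective_iff_hasProjectiveDimensionLT_one]
  have := Module.projective_of_isSemisimpleRing (MvPolynomial (Fin 0) k) M
  exact ModuleCat.projective_of_categoryTheory_projective M

theorem hilbert {k : Type} [Field k] (d : ℕ) : ∀ (M : ModuleCat.{0} (MvPolynomial (Fin d) k)),
    HasProjectiveDimensionLT M (d + 1) := by
  induction d with
  | zero => exact base_proj
  | succ d ih =>
    let e := (MvPolynomial.finSuccEquiv k d).symm.toRingEquiv
    let : Algebra (MvPolynomial (Fin d) k) (MvPolynomial (Fin (d + 1)) k) :=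
      (e.toRingHom.comp Polynomial.C).toAlgebra
    let e' : Polynomial (MvPolynomial (Fin d) k) ≃ₐ[MvPolynomial (Fin d) k]
        MvPolynomial (Fin (d + 1)) k := AlgEquiv.ofRingEquiv (f := e) (fun r => rfl)
    refine poly_pd ((Polynomial.basisMonomials _).map e'.toLinearEquiv) (e' Polynomial.X) ?_ d ih
    intro k
    simp [← map_pow, Polynomial.X_pow_eq_monomial]
end


section res
variable {S : Type} [CommRing S] [IsNoetherianRing S]

theorem exists_cover (M : Type) [AddCommGroup M] [Module S M] [Module.Finite S M] :
    ∃ p : (Σ n : ℕ, (Fin n → S) →ₗ[S] M), Function.Surjective p.2 := by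
  obtain ⟨n, f, hf⟩ := Module.Finite.exists_fin' S M
  exact ⟨⟨n, f⟩, hf⟩

/-- a chosen finite free cover -/
noncomputable def cover (M : Type) [AddCommGroup M] [Module S M] [Module.Finite S M] :
    Σ n : ℕ, (Fin n → S) →ₗ[S] M := (exists_cover M).choose

theorem cover_surj (M : Type) [AddCommGroup M] [Module S M] [Module.Finite S M] :
    Function.Surjective (cover (S := S) M).2 := (exists_cover M).choose_spec

variable (M : Type) [AddCommGroup M] [Module S M] [Module.Finite S M]

/-- the state: rank and submodule of the free module (the next syzygy) -/
noncomputable def resState : ℕ → Σ n : ℕ, Submodule S (Fin n → S)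
  | 0 => ⟨(cover (S := S) M).1, LinearMap.ker (cover (S := S) M).2⟩
  | n + 1 => ⟨(cover (S := S) (resState n).2).1, LinearMap.ker (cover (S := S) (resState n).2).2⟩

/-- the map onto a submodule -/
noncomputable def coverMap {r : ℕ} (K : Submodule S (Fin r → S)) :
    (Fin (cover (S := S) K).1 → S) →ₗ[S] (Fin r → S) :=
  K.subtype.comp (M₂ := K) (cover (S := S) K).2

theorem coverMap_range {r : ℕ} (K : Submodule S (Fin r → S)) :
    LinearMap.range (coverMap K) = K := by
  ext v
  constructor
  · rintro ⟨w, rfl⟩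
    exact ((cover (S := S) K).2 w).2
  · intro hv
    obtain ⟨w, hw⟩ := cover_surj (S := S) K ⟨v, hv⟩
    exact ⟨w, congrArg Subtype.val hw⟩

theorem coverMap_ker {r : ℕ} (K : Submodule S (Fin r → S)) :
    LinearMap.ker (coverMap K) = LinearMap.ker (cover (S := S) K).2 := by
  ext v
  exact ⟨fun h => Subtype.ext h, fun h => congrArg Subtype.val h⟩

/-- A resolution by finite free modules. -/
structure FinRes (S : Type) [CommRing S] (M : Type) [AddCommGroup M] [Module S M] where
  /-- ranks -/
  r : ℕ → ℕ
  /-- differentials -/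
  d : ∀ n, (Fin (r (n + 1)) → S) →ₗ[S] (Fin (r n) → S)
  /-- augmentation -/
  π : (Fin (r 0) → S) →ₗ[S] M
  surj : Function.Surjective π
  ex0 : Function.Exact (d 0) π
  ex : ∀ n, Function.Exact (d (n + 1)) (d n)

theorem coverMap_exact {r : ℕ} (K : Submodule S (Fin r → S)) :
    Function.Exact (coverMap (LinearMap.ker (cover (S := S) K).2)) (coverMap K) := by
  rw [LinearMap.exact_iff, coverMap_range, coverMap_ker]

theorem cover_exact :
    Function.Exact (coverMap (LinearMap.ker (cover (S := S) M).2)) (cover (S := S) M).2 := by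
  intro v
  have := coverMap_range (LinearMap.ker (cover (S := S) M).2)
  exact (SetLike.ext_iff.1 this v).symm

theorem exists_finRes : Nonempty (FinRes S M) :=
  ⟨{ r := fun n => (resState (S := S) M n).1
     d := fun n => coverMap (resState (S := S) M n).2
     π := (cover (S := S) M).2
     surj := cover_surj M
     ex0 := cover_exact M
     ex := fun n => coverMap_exact (resState (S := S) M n).2 }⟩

variable {M} (P : FinRes S M)

theorem FinRes.comp (n : ℕ) : P.d n ∘ₗ P.d (n + 1) = 0 := (P.ex n).linearMap_comp_eq_zero

/-- the complex -/
noncomputable def resComplex : ChainComplex (ModuleCat.{0} S) ℕ :=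
  ChainComplex.of (fun n => ModuleCat.of S (Fin (P.r n) → S))
    (fun n => ModuleCat.ofHom (P.d n)) (fun n => by
      rw [← ModuleCat.ofHom_comp, P.comp]; rfl)

theorem resComplex_d (n : ℕ) : (resComplex P).d (n + 1) n = ModuleCat.ofHom (P.d n) :=
  ChainComplex.of_d (fun n => ModuleCat.of S (Fin (P.r n) → S))
    (fun n => ModuleCat.ofHom (P.d n)) n

theorem resComplex_exactAt_succ (n : ℕ) : (resComplex P).ExactAt (n + 1) := by
  rw [HomologicalComplex.exactAt_iff' _ (n + 1 + 1) (n + 1) n (by simp) (by simp)]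
  rw [ShortComplex.ShortExact.moduleCat_exact_iff_function_exact]
  change Function.Exact ((resComplex P).d (n+1+1) (n+1)) ((resComplex P).d (n+1) n)
  rw [resComplex_d, resComplex_d]
  exact P.ex n

/-- augmentation -/
noncomputable def resAug : (resComplex P).X 0 ⟶ ModuleCat.of S M :=
  ModuleCat.ofHom P.π

theorem d_resAug : (resComplex P).d 1 0 ≫ resAug P = 0 := by
  rw [resComplex_d]
  change ModuleCat.ofHom (P.d 0) ≫ ModuleCat.ofHom P.π = 0
  rw [← ModuleCat.ofHom_comp, (P.ex0).linearMap_comp_eq_zero]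
  rfl

/-- finite free resolution -/
noncomputable def finRes : ProjectiveResolution (ModuleCat.of S M) where
  complex := resComplex P
  projective n := by
    change Projective (ModuleCat.of S (Fin (P.r n) → S))
    rw [← IsProjective.iff_projective]; infer_instance
  π := (ChainComplex.toSingle₀Equiv _ _).symm ⟨resAug P, d_resAug P⟩
  quasiIso := ⟨fun n => by
    cases n
    · rw [ChainComplex.quasiIsoAt₀_iff, ShortComplex.quasiIso_iff_of_zeros']
      · refine (ShortComplex.exact_and_epi_g_iff_of_iso
          (S₂ := ShortComplex.mk _ _ (d_resAug P)) ?_).2 ⟨?_, ?_⟩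
        · exact ShortComplex.isoMk (Iso.refl _) (Iso.refl _) (Iso.refl _)
            (by simp; rfl) (by simp; rfl)
        · rw [ShortComplex.ShortExact.moduleCat_exact_iff_function_exact]
          change Function.Exact ((resComplex P).d 1 0) (resAug P)
          rw [show (resComplex P).d 1 0 = ModuleCat.ofHom (P.d 0) from resComplex_d P 0]
          exact P.ex0
        · exact (ModuleCat.epi_iff_surjective _).2 P.surj
      all_goals rfl
    · rw [quasiIsoAt_iff_exactAt']
      · apply resComplex_exactAt_succ
      · apply ChainComplex.exactAt_succ_single_obj⟩

theorem ext_ann (i : ℕ) (x : S) (hx : x ∈ Module.annihilator S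
      (((Ext S (ModuleCat.{0} S) i).obj (Opposite.op (ModuleCat.of S M))).obj (ModuleCat.of S S)))
    (f : (Fin (P.r i) → S) →ₗ[S] S) (hf : f ∘ₗ P.d i = 0) :
    ∃ w : (resComplex P).X ((ComplexShape.up ℕ).prev i) ⟶ ModuleCat.of S S,
      (resComplex P).d i ((ComplexShape.up ℕ).prev i) ≫ w = ModuleCat.ofHom (x • f) := by
  rw [((finRes P).isoExt i (ModuleCat.of S S)).toLinearEquiv.annihilator_eq] at hx
  obtain ⟨w, hw⟩ := ann_homology
    (((resComplex P).linearYonedaObj S (ModuleCat.of S S)).sc i) x hx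
    (ModuleCat.ofHom f : (resComplex P).X i ⟶ ModuleCat.of S S) (by
      change (resComplex P).d ((ComplexShape.up ℕ).next i) i ≫ _ = 0
      have : (ComplexShape.up ℕ).next i = i + 1 := by simp
      rw [this, resComplex_d]
      change ModuleCat.ofHom (P.d i) ≫ ModuleCat.ofHom f = 0
      rw [← ModuleCat.ofHom_comp, hf]
      rfl)
  exact ⟨w, hw⟩

theorem ext_ann_zero (x : S) (hx : x ∈ Module.annihilator S
      (((Ext S (ModuleCat.{0} S) 0).obj (Opposite.op (ModuleCat.of S M))).obj (ModuleCat.of S S)))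
    (f : (Fin (P.r 0) → S) →ₗ[S] S) (hf : f ∘ₗ P.d 0 = 0) : x • f = 0 := by
  obtain ⟨w, hw⟩ := ext_ann P 0 x hx f hf
  rw [HomologicalComplex.shape _ _ _ (by simp)] at hw
  have := congrArg ModuleCat.Hom.hom hw
  rw [Limits.zero_comp] at this
  exact this.symm

theorem ext_ann_succ (i : ℕ) (x : S) (hx : x ∈ Module.annihilator S
      (((Ext S (ModuleCat.{0} S) (i+1)).obj (Opposite.op (ModuleCat.of S M))).obj
        (ModuleCat.of S S)))
    (f : (Fin (P.r (i+1)) → S) →ₗ[S] S) (hf : f ∘ₗ P.d (i+1) = 0) :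
    ∃ g : (Fin (P.r i) → S) →ₗ[S] S, g ∘ₗ P.d i = x • f := by
  have h := ext_ann P (i+1) x hx f hf
  have : (ComplexShape.up ℕ).prev (i+1) = i := by simp
  rw [this] at h
  obtain ⟨w, hw⟩ := h
  rw [resComplex_d] at hw
  exact ⟨w.hom, congrArg ModuleCat.Hom.hom hw⟩

theorem syz_pd (D : ℕ) (hD : ∀ N : ModuleCat.{0} S, HasProjectiveDimensionLT N (D + 1)) :
    ∀ n e, n + e = D → HasProjectiveDimensionLT
      (ModuleCat.of S ((Fin (P.r n) → S) ⧸ LinearMap.range (P.d n)))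
      (e + 1) := by
  intro n
  induction n with
  | zero =>
    intro e he
    obtain rfl : e = D := by omega
    exact hD _
  | succ n ih =>
    intro e he
    have h := ih (e + 1) (by omega)
    let j := (LinearMap.range (P.d (n+1))).liftQ (P.d n)
      ((P.ex n).linearMap_ker_eq ▸ le_rfl)
    have hj : Function.Injective j := by
      rw [← LinearMap.ker_eq_bot]
      apply Submodule.ker_liftQ_eq_bot
      exact (P.ex n).linearMap_ker_eq.le
    have hr : LinearMap.range j = LinearMap.range (P.d n) := Submodule.range_liftQ _ _ _
    have hex : Function.Exact j (LinearMap.range (P.d n)).mkQ := by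
      rw [LinearMap.exact_iff, Submodule.ker_mkQ, hr]
    let T := ModuleCat.shortComplexOfCompEqZero j _ hex.linearMap_comp_eq_zero
    have hT : T.ShortExact :=
      ModuleCat.shortComplex_shortExact _ hex hj (Submodule.mkQ_surjective _)
    have h4 : Projective T.X₂ := by
      change Projective (ModuleCat.of S (Fin (P.r n) → S))
      rw [← IsProjective.iff_projective]; infer_instance
    exact (hT.hasProjectiveDimensionLT_X₃_iff e h4).1 h

variable (M) in
theorem main_ann (D : ℕ) (hD : ∀ N : ModuleCat.{0} S, HasProjectiveDimensionLT N (D + 1))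
    (x : ℕ → S) (hx : ∀ i ∈ Finset.range (D+1), x i ∈ Module.annihilator S
      (((Ext S (ModuleCat.{0} S) i).obj (Opposite.op (ModuleCat.of S M))).obj
        (ModuleCat.of S S))) (m : M) : (∏ i ∈ Finset.range (D+1), x i) • m = 0 := by
  obtain ⟨P⟩ := exists_finRes (S := S) M
  have hp := syz_pd P D hD D 0 rfl
  rw [zero_add, ← projective_iff_hasProjectiveDimensionLT_one,
    ← IsProjective.iff_projective] at hp
  obtain ⟨s, hs⟩ := Module.projective_lifting_property
    (LinearMap.range (P.d D)).mkQ LinearMap.id (Submodule.mkQ_surjective _)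
  let x' : ℕ → S := fun i => if i ∈ Finset.range (D+1) then x i else 0
  have hx' : ∀ i, x' i ∈ Module.annihilator S
      (((Ext S (ModuleCat.{0} S) i).obj (Opposite.op (ModuleCat.of S M))).obj
        (ModuleCat.of S S)) := by
    intro i
    by_cases h : i ∈ Finset.range (D+1)
    · simp only [x', if_pos h]; exact hx i h
    · simp only [x', if_neg h]; exact zero_mem _
  obtain ⟨v, rfl⟩ := P.surj m
  have := core P.r (P.d)
    (fun n v => LinearMap.congr_fun (P.comp n) v) x'
    (fun f hf => ext_ann_zero P _ (hx' 0) f hf)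
    (fun i f hf => ext_ann_succ P i _ (hx' _) f hf) D
    ⟨s ∘ₗ (LinearMap.range (P.d D)).mkQ, by
      rw [LinearMap.comp_assoc, LinearMap.range_mkQ_comp, LinearMap.comp_zero], fun v => by
      rw [← Submodule.Quotient.mk_eq_zero, Submodule.Quotient.mk_sub, sub_eq_zero]
      exact LinearMap.congr_fun hs _⟩ v
  have h2 : P.π ((∏ i ∈ Finset.range (D+1), x' i) • v) = 0 := (P.ex0 _).2 this
  rw [map_smul] at h2
  rw [← h2]
  congr 1
  exact Finset.prod_congr rfl fun i hi => by simp only [x', if_pos hi]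
end res

open Pointwise in
theorem prod_ideal_le {S : Type} [CommRing S] (I : Ideal S) (s : Finset ℕ) (a : ℕ → Ideal S)
    (h : ∀ x : ℕ → S, (∀ i ∈ s, x i ∈ a i) → ∏ i ∈ s, x i ∈ I) : ∏ i ∈ s, a i ≤ I := by
  have : ∏ i ∈ s, a i = Ideal.span (∏ i ∈ s, (a i : Set S)) := by
    rw [← Ideal.prod_span]
    simp
  rw [this, Ideal.span_le]
  intro y hy
  obtain ⟨g, hg, rfl⟩ := Set.mem_finsetProd _ _ _ |>.1 hy
  exact h g (fun i hi => hg hi)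

/-- Let `S = k[x₁,…,x_d]` be a polynomial ring in `d` variables over a field, `I` a proper
homogeneous ideal, `R = S/I`, and `𝔞ᵢ = Ann_S Ext^i_S(R, S)`.  Then `𝔞₀ 𝔞₁ ⋯ 𝔞_d ⊆ I`. -/
theorem prod_ann_ext_le {k : Type} [Field k] {d : ℕ}
    (I : Ideal (MvPolynomial (Fin d) k)) (hI : I ≠ ⊤)
    (hIhom : ∀ f ∈ I, ∀ j : ℕ, MvPolynomial.homogeneousComponent j f ∈ I)
    (𝔞 : ℕ → Ideal (MvPolynomial (Fin d) k))
    (h𝔞 : ∀ i : ℕ, 𝔞 i = Module.annihilator (MvPolynomial (Fin d) k)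
      (((Ext (MvPolynomial (Fin d) k) (ModuleCat.{0} (MvPolynomial (Fin d) k)) i).obj
          (Opposite.op (ModuleCat.of (MvPolynomial (Fin d) k)
            (MvPolynomial (Fin d) k ⧸ I)))).obj
        (ModuleCat.of (MvPolynomial (Fin d) k) (MvPolynomial (Fin d) k)))) :
    ∏ i ∈ Finset.range (d + 1), 𝔞 i ≤ I := by
  apply prod_ideal_le
  intro x hx
  have h := main_ann (MvPolynomial (Fin d) k ⧸ I) d (hilbert d) x
    (fun i hi => h𝔞 i ▸ hx i hi) (Ideal.Quotient.mk I 1)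
  rw [← Ideal.Quotient.eq_zero_iff_mem, ← h, ← mul_one (∏ i ∈ Finset.range (d + 1), x i)]
  rw [map_mul, mul_one]
  rfl
end

section
/- Let S be a polynomial ring over an algebraically closed field and let x, y, a₃, a₄, b₃, b₄ be linear forms with ht(x,y) = 2, ht(x, b₃, b₄) = 3, ht(a₃, a₄, b₃, b₄) = 4, and ht(a₃x+b₃y, a₄x+b₄y) = 2. Set q₃ = a₃x+b₃y, q₄ = a₄x+b₄y, and J = (b₃x, b₄x, q₃). Then the colon ideal (J : q₄) equals (b₃, b₄x, a₃x). -/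
open MvPolynomial

/-- The height of an ideal: the infimum of the heights of the primes containing it. -/
noncomputable def idealHeight {S : Type} [CommRing S] (I : Ideal S) : ℕ∞ :=
  ⨅ p ∈ {p : PrimeSpectrum S | I ≤ p.asIdeal}, Order.height p

theorem linforms_prime {k : Type} [Field k] {n : ℕ} (s : Set (MvPolynomial (Fin n) k))
    (hs : s ⊆ homogeneousSubmodule (Fin n) k 1) : (Ideal.span s).IsPrime := by
  let W : Submodule k (MvPolynomial (Fin n) k) := Submodule.span k s
  obtain ⟨g, hg⟩ := W.mkQ.exists_rightInverse_of_surjective (Submodule.range_mkQ W)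
  let P : MvPolynomial (Fin n) k →ₗ[k] MvPolynomial (Fin n) k := g ∘ₗ W.mkQ
  have hP0 : ∀ w ∈ W, P w = 0 := by
    intro w hw
    have : W.mkQ w = 0 := by simpa using hw
    simp only [P, LinearMap.comp_apply, this, map_zero]
  have hPW : ∀ w, P w - w ∈ W := by
    intro w
    rw [← Submodule.ker_mkQ W, LinearMap.mem_ker, map_sub]
    have := LinearMap.congr_fun hg (W.mkQ w)
    simp only [P, LinearMap.comp_apply, LinearMap.id_apply] at this ⊢
    rw [this, sub_self]
  have hWI : ∀ w ∈ W, w ∈ Ideal.span s := by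
    intro w hw
    have : W ≤ (Ideal.span s).restrictScalars k :=
      Submodule.span_le.mpr Ideal.subset_span
    exact this hw
  let φ : MvPolynomial (Fin n) k →ₐ[k] MvPolynomial (Fin n) k := aeval (fun i => P (X i))
  have hφP : ∀ w ∈ homogeneousSubmodule (Fin n) k 1, φ w = P w := by
    intro w hw
    rw [homogeneousSubmodule_one_eq_span_X] at hw
    have : Set.EqOn φ.toLinearMap P
        (Submodule.span k (Set.range X) : Submodule k (MvPolynomial (Fin n) k)) := by
      apply LinearMap.eqOn_span'
      rintro _ ⟨i, rfl⟩
      simp [φ]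
    exact this hw
  have hφ : ∀ f, φ f - f ∈ Ideal.span s := by
    have : ((Ideal.Quotient.mkₐ k (Ideal.span s)).comp φ) = Ideal.Quotient.mkₐ k (Ideal.span s) := by
      apply MvPolynomial.algHom_ext
      intro i
      simp only [AlgHom.comp_apply, φ, aeval_X, Ideal.Quotient.mkₐ_eq_mk]
      exact Ideal.Quotient.eq.mpr (hWI _ (hPW _))
    intro f
    exact Ideal.Quotient.eq.mp (DFunLike.congr_fun this f)
  have hker : Ideal.span s = RingHom.ker φ := by
    apply le_antisymm
    · rw [Ideal.span_le]
      intro w hw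
      have := hφP w (hs hw)
      rw [hP0 w (Submodule.subset_span hw)] at this
      exact this
    · intro f hf
      have h1 := hφ f
      rw [RingHom.mem_ker] at hf
      rw [hf, zero_sub] at h1
      simpa using h1
  rw [hker]
  exact RingHom.ker_isPrime _

theorem regular_of_height {k : Type} [Field k] {n : ℕ} (s : Set (MvPolynomial (Fin n) k))
    (hf : s.Finite) (hs : s ⊆ homogeneousSubmodule (Fin n) k 1)
    (a : MvPolynomial (Fin n) k)
    (h : (s.ncard : ℕ∞) < idealHeight (Ideal.span (insert a s)))
    (v : MvPolynomial (Fin n) k) (hv : v * a ∈ Ideal.span s) : v ∈ Ideal.span s := by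
  have hp := linforms_prime s hs
  refine (hp.mem_or_mem hv).resolve_right fun ha => ?_
  refine absurd h (not_lt.mpr ?_)
  have hle : Ideal.span (insert a s) ≤ Ideal.span s := by
    rw [Ideal.span_le, Set.insert_subset_iff]
    exact ⟨ha, Ideal.subset_span⟩
  have h1 : (Ideal.span s).height ≤ s.ncard :=
    Ideal.height_le_card_of_mem_minimalPrimes_span hf (by
      rw [Ideal.minimalPrimes_eq_subsingleton_self]; rfl)
  refine le_trans ?_ h1
  rw [PrimeSpectrum.height_eq_orderHeight ⟨Ideal.span s, hp⟩]
  exact iInf₂_le (⟨Ideal.span s, hp⟩ : PrimeSpectrum _) hle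

theorem ncard_two_le {S : Type} (a b : S) : ({a, b} : Set S).ncard ≤ 2 :=
  (Set.ncard_insert_le _ _).trans (by simp)

theorem height_lt_of_ncard {S : Type} [CommRing S] {I I' : Ideal S} {m m' : ℕ} {c : ℕ}
    (h : idealHeight I = m) (hI : I' = I) (hc : c ≤ m') (hm : m' < m) :
    (c : ℕ∞) < idealHeight I' := by
  rw [hI, h]
  exact_mod_cast lt_of_le_of_lt hc hm

/-- Let `S` be a polynomial ring over an algebraically closed field and `x, y, a₃, a₄, b₃, b₄`
linear forms with `ht(x,y) = 2`, `ht(x,b₃,b₄) = 3`, `ht(a₃,a₄,b₃,b₄) = 4` and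
`ht(q₃,q₄) = 2`, where `qᵢ = aᵢx + bᵢy`.  Then for `J = (b₃x, b₄x, q₃)` one has
`(J : q₄) = (b₃, b₄x, a₃x)`. -/
theorem colon_computation {k : Type} [Field k] [IsAlgClosed k] {n : ℕ}
    (x y a₃ a₄ b₃ b₄ : MvPolynomial (Fin n) k)
    (hx : x ∈ homogeneousSubmodule (Fin n) k 1) (hy : y ∈ homogeneousSubmodule (Fin n) k 1)
    (ha₃ : a₃ ∈ homogeneousSubmodule (Fin n) k 1) (ha₄ : a₄ ∈ homogeneousSubmodule (Fin n) k 1)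
    (hb₃ : b₃ ∈ homogeneousSubmodule (Fin n) k 1) (hb₄ : b₄ ∈ homogeneousSubmodule (Fin n) k 1)
    (q₃ q₄ : MvPolynomial (Fin n) k)
    (hq₃ : q₃ = a₃ * x + b₃ * y) (hq₄ : q₄ = a₄ * x + b₄ * y)
    (h₁ : idealHeight (Ideal.span {x, y}) = 2)
    (h₂ : idealHeight (Ideal.span {x, b₃, b₄}) = 3)
    (h₃ : idealHeight (Ideal.span {a₃, a₄, b₃, b₄}) = 4)
    (h₄ : idealHeight (Ideal.span {q₃, q₄}) = 2)
    (J : Ideal (MvPolynomial (Fin n) k)) (hJ : J = Ideal.span {b₃ * x, b₄ * x, q₃}) :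
    J.colon (Ideal.span {q₄}) = Ideal.span {b₃, b₄ * x, a₃ * x} := by
  have mem3 : ∀ {f p q r : MvPolynomial (Fin n) k}, f ∈ Ideal.span {p, q, r} ↔
      ∃ α β γ, α * p + β * q + γ * r = f := by
    intro f p q r
    simp only [Ideal.mem_span_insert, Ideal.mem_span_singleton']
    constructor
    · rintro ⟨α, _, ⟨β, _, ⟨γ, rfl⟩, rfl⟩, rfl⟩
      exact ⟨α, β, γ, by ring⟩
    · rintro ⟨α, β, γ, rfl⟩
      exact ⟨α, _, ⟨β, _, ⟨γ, rfl⟩, rfl⟩, by ring⟩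
  -- the regularity facts
  have hA : ∀ v, v * y ∈ Ideal.span {x} → v ∈ Ideal.span {x} := by
    refine regular_of_height {x} (Set.finite_singleton _) (by simpa using hx) y ?_
    exact height_lt_of_ncard (m' := 1) h₁ (by rw [Set.pair_comm]) (by simp) (by norm_num)
  have hB : ∀ v, v * x ∈ Ideal.span {b₃, b₄} → v ∈ Ideal.span {b₃, b₄} := by
    refine regular_of_height {b₃, b₄} (Set.toFinite _)
      (by rintro z (rfl | rfl) <;> assumption) x ?_
    exact height_lt_of_ncard (m' := 2) h₂ rfl (ncard_two_le _ _) (by norm_num)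
  have hC : ∀ v, v * a₄ ∈ Ideal.span {a₃, b₃, b₄} → v ∈ Ideal.span {a₃, b₃, b₄} := by
    refine regular_of_height {a₃, b₃, b₄} (Set.toFinite _)
      (by rintro z (rfl | rfl | rfl) <;> assumption) a₄ ?_
    exact height_lt_of_ncard (m' := 3) h₃ (by rw [Set.insert_comm])
      ((Set.ncard_insert_le _ _).trans (Nat.succ_le_succ (ncard_two_le _ _))) (by norm_num)
  have hb : ∀ v, v * b₄ ∈ Ideal.span {b₃} → v ∈ Ideal.span {b₃} := by
    intro v hv
    have hp := linforms_prime {b₃} (by simpa using hb₃)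
    refine (hp.mem_or_mem hv).resolve_right fun h4 => ?_
    have := regular_of_height {x, b₃} (Set.toFinite _)
      (by rintro z (rfl | rfl) <;> assumption) b₄
      (height_lt_of_ncard (m' := 2) h₂ (by rw [Set.insert_comm, Set.pair_comm b₄])
        (ncard_two_le _ _) (by norm_num)) 1
      (by rw [one_mul]; exact Ideal.span_mono (by simp) h4)
    exact (linforms_prime {x, b₃} (by rintro z (rfl | rfl) <;> assumption)).one_notMem this
  have hx0 : x ≠ 0 := by
    rintro rfl
    have h1 := regular_of_height {y} (Set.finite_singleton _) (by simpa using hy) 0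
      (height_lt_of_ncard (m' := 1) h₁ rfl (by simp) (by norm_num)) 1 (by simp)
    exact (linforms_prime {y} (by simpa using hy)).one_notMem h1
  have hb0 : b₃ ≠ 0 := by
    rintro rfl
    have h1 := regular_of_height {x, b₄} (Set.toFinite _)
      (by rintro z (rfl | rfl) <;> assumption) 0
      (height_lt_of_ncard (m' := 2) h₂ (by rw [Set.insert_comm])
        (ncard_two_le _ _) (by norm_num)) 1 (by simp)
    exact (linforms_prime {x, b₄} (by rintro z (rfl | rfl) <;> assumption)).one_notMem h1
  ext f
  rw [Ideal.mem_colon_span_singleton, hJ, mem3, mem3]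
  subst hq₃ hq₄
  constructor
  · rintro ⟨α, β, γ, h⟩
    obtain ⟨t, ht⟩ := Ideal.mem_span_singleton'.mp (hA (f * b₄ - γ * b₃)
      (Ideal.mem_span_singleton'.mpr ⟨α * b₃ + β * b₄ + γ * a₃ - f * a₄, by
        linear_combination h⟩))
    have ht2 : α * b₃ + β * b₄ + γ * a₃ - f * a₄ = y * t := by
      apply mul_left_cancel₀ hx0
      linear_combination h - y * ht
    obtain ⟨u, v, huv⟩ := Ideal.mem_span_pair.mp (hB t
      (Ideal.mem_span_pair.mpr ⟨-γ, f, by linear_combination -ht⟩))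
    obtain ⟨w, hw⟩ := Ideal.mem_span_singleton'.mp (hb (f - x * v)
      (Ideal.mem_span_singleton'.mpr ⟨γ + x * u, by linear_combination ht + x * huv⟩))
    have hγ : γ = b₄ * w - x * u := by
      apply mul_left_cancel₀ hb0
      linear_combination ht + x * huv - b₄ * hw
    obtain ⟨c, d, hcd⟩ := Ideal.mem_span_pair.mp (hB (u * a₃ + v * a₄)
      (Ideal.mem_span_pair.mpr ⟨α - w * a₄ - y * u, β + w * a₃ - y * v, by
        linear_combination ht2 - a₃ * hγ - a₄ * hw - y * huv⟩))
    obtain ⟨l, m, r, hv⟩ := mem3.mp (hC v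
      (mem3.mpr ⟨-u, c, d, by linear_combination hcd⟩))
    exact ⟨w + x * m, r, l, by linear_combination hw + x * hv⟩
  · rintro ⟨α, β, γ, rfl⟩
    exact ⟨α * a₄ + β * 0 - γ * y * a₄, β * (a₄ * x + b₄ * y) - α * a₃ + γ * y * a₃,
      α * b₄ + γ * (a₄ * x + b₄ * y) - γ * y * b₄, by ring⟩
end

section
/- Let S be a polynomial ring over a field and let x, y, b₃, a₃ be linear forms with ht(x, b₃, b₄) = 3 and ht(x, y, a₃, b₃) = 4, where q₃ = a₃x + b₃y. Set J = (x², b₃x, q₃). Then J = I₂(M) for the 2×3 matrix M with rows (b₃, −x, 0) and (a₃, y, −x), J is a Cohen–Macaulay ideal of height 2, and the multiplicity e(S/J) = 3. -/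
open MvPolynomial

/-- The Hilbert function of `S/J` in degree `d`. -/
noncomputable def hilbertFn {k : Type} [Field k] {n : ℕ}
    (J : Ideal (MvPolynomial (Fin n) k)) (d : ℕ) : ℕ :=
  Module.finrank k
    ((MvPolynomial.homogeneousSubmodule (Fin n) k d).map
      (Ideal.Quotient.mkₐ k J).toLinearMap)

/-- The Hilbert series of `S/J` as a formal power series over `ℚ`. -/
noncomputable def hilbertSeries {k : Type} [Field k] {n : ℕ}
    (J : Ideal (MvPolynomial (Fin n) k)) : PowerSeries ℚ :=
  PowerSeries.mk fun d => (hilbertFn J d : ℚ)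

/-- `S/J` is a graded Cohen–Macaulay ring of dimension `n - c`: some homogeneous system of
parameters (of length `n - c`) is a regular sequence on `S/J`, with Artinian quotient. -/
def IsGradedCMQuotient {k : Type} [Field k] {n : ℕ}
    (J : Ideal (MvPolynomial (Fin n) k)) (c : ℕ) : Prop :=
  ∃ l : List (MvPolynomial (Fin n) k),
    l.length = n - c ∧
    (∀ f ∈ l, ∃ d : ℕ, f ∈ MvPolynomial.homogeneousSubmodule (Fin n) k (d + 1)) ∧
    RingTheory.Sequence.IsRegular (MvPolynomial (Fin n) k ⧸ J) l ∧
    Module.Finite k (MvPolynomial (Fin n) k ⧸ (J + Ideal.span {f | f ∈ l}))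

/-! ### The model algebra `A ⊕ A ξ ⊕ A β` -/

/-- The rank-three algebra `A ⊕ A ξ ⊕ A β` with `ξ² = ξβ = 0`, `β² = -a ξ - w β`. -/
@[ext]
structure HBAlg (A : Type) (a w : A) where
  /-- coordinate along `1` -/
  c0 : A
  /-- coordinate along `ξ` -/
  c1 : A
  /-- coordinate along `β` -/
  c2 : A

namespace HBAlg

variable {A : Type} [CommRing A] {a w : A}

instance : Add (HBAlg A a w) := ⟨fun u v => ⟨u.c0 + v.c0, u.c1 + v.c1, u.c2 + v.c2⟩⟩
instance : Neg (HBAlg A a w) := ⟨fun u => ⟨-u.c0, -u.c1, -u.c2⟩⟩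
instance : Zero (HBAlg A a w) := ⟨⟨0, 0, 0⟩⟩
instance : One (HBAlg A a w) := ⟨⟨1, 0, 0⟩⟩
instance : Mul (HBAlg A a w) := ⟨fun u v =>
  ⟨u.c0 * v.c0, u.c0 * v.c1 + u.c1 * v.c0 - a * (u.c2 * v.c2),
    u.c0 * v.c2 + u.c2 * v.c0 - w * (u.c2 * v.c2)⟩⟩

@[simp] lemma add_c0 (u v : HBAlg A a w) : (u + v).c0 = u.c0 + v.c0 := rfl
@[simp] lemma add_c1 (u v : HBAlg A a w) : (u + v).c1 = u.c1 + v.c1 := rfl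
@[simp] lemma add_c2 (u v : HBAlg A a w) : (u + v).c2 = u.c2 + v.c2 := rfl
@[simp] lemma neg_c0 (u : HBAlg A a w) : (-u).c0 = -u.c0 := rfl
@[simp] lemma neg_c1 (u : HBAlg A a w) : (-u).c1 = -u.c1 := rfl
@[simp] lemma neg_c2 (u : HBAlg A a w) : (-u).c2 = -u.c2 := rfl
@[simp] lemma zero_c0 : (0 : HBAlg A a w).c0 = 0 := rfl
@[simp] lemma zero_c1 : (0 : HBAlg A a w).c1 = 0 := rfl
@[simp] lemma zero_c2 : (0 : HBAlg A a w).c2 = 0 := rfl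
@[simp] lemma one_c0 : (1 : HBAlg A a w).c0 = 1 := rfl
@[simp] lemma one_c1 : (1 : HBAlg A a w).c1 = 0 := rfl
@[simp] lemma one_c2 : (1 : HBAlg A a w).c2 = 0 := rfl
@[simp] lemma mul_c0 (u v : HBAlg A a w) : (u * v).c0 = u.c0 * v.c0 := rfl
@[simp] lemma mul_c1 (u v : HBAlg A a w) :
    (u * v).c1 = u.c0 * v.c1 + u.c1 * v.c0 - a * (u.c2 * v.c2) := rfl
@[simp] lemma mul_c2 (u v : HBAlg A a w) :
    (u * v).c2 = u.c0 * v.c2 + u.c2 * v.c0 - w * (u.c2 * v.c2) := rfl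

instance : CommRing (HBAlg A a w) := CommRing.ofMinimalAxioms
  (fun u v t => by ext <;> simp <;> ring)
  (fun u => by ext <;> simp)
  (fun u => by ext <;> simp)
  (fun u v t => by ext <;> simp <;> ring)
  (fun u v => by ext <;> simp <;> ring)
  (fun u => by ext <;> simp)
  (fun u v t => by ext <;> simp <;> ring)

instance {R : Type} [CommSemiring R] [Algebra R A] : Algebra R (HBAlg A a w) where
  smul r u := ⟨r • u.c0, r • u.c1, r • u.c2⟩
  algebraMap :=
    { toFun := fun r => ⟨algebraMap R A r, 0, 0⟩
      map_one' := by ext <;> simp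
      map_zero' := by ext <;> simp
      map_add' := fun r s => by ext <;> simp
      map_mul' := fun r s => by ext <;> simp }
  commutes' r u := mul_comm _ _
  smul_def' r u := by
    ext
    · change r • u.c0 = algebraMap R A r * u.c0
      rw [Algebra.smul_def]
    · change r • u.c1 = algebraMap R A r * u.c1 + 0 * u.c0 - a * (0 * u.c2)
      rw [Algebra.smul_def]; ring
    · change r • u.c2 = algebraMap R A r * u.c2 + 0 * u.c0 - w * (0 * u.c2)
      rw [Algebra.smul_def]; ring

section
variable {R : Type} [CommSemiring R] [Algebra R A]
@[simp] lemma smul_c0 (r : R) (u : HBAlg A a w) : (r • u).c0 = r • u.c0 := rfl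
@[simp] lemma smul_c1 (r : R) (u : HBAlg A a w) : (r • u).c1 = r • u.c1 := rfl
@[simp] lemma smul_c2 (r : R) (u : HBAlg A a w) : (r • u).c2 = r • u.c2 := rfl
@[simp] lemma algebraMap_c0 (r : R) : (algebraMap R (HBAlg A a w) r).c0 = algebraMap R A r := rfl
@[simp] lemma algebraMap_c1 (r : R) : (algebraMap R (HBAlg A a w) r).c1 = 0 := rfl
@[simp] lemma algebraMap_c2 (r : R) : (algebraMap R (HBAlg A a w) r).c2 = 0 := rfl

instance : IsScalarTower R A (HBAlg A a w) :=
  IsScalarTower.of_algebraMap_eq (fun r => by ext <;> simp)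

/-- The coordinates of the model algebra. -/
def equivProd : HBAlg A a w ≃ₗ[R] A × A × A where
  toFun u := (u.c0, u.c1, u.c2)
  invFun v := ⟨v.1, v.2.1, v.2.2⟩
  map_add' _ _ := rfl
  map_smul' _ _ := rfl
  left_inv _ := rfl
  right_inv _ := rfl
end

instance : Module.Free A (HBAlg A a w) := Module.Free.of_equiv (equivProd (R := A)).symm

/-- The map from the model algebra to an algebra where the defining relations hold. -/
def lift {R : Type} [CommSemiring R] [Algebra R A] {T : Type} [CommRing T] [Algebra R T]
    (f : A →ₐ[R] T) (x b : T)
    (h1 : x * x = 0) (h2 : b * x = 0) (h3 : f a * x + b * b + f w * b = 0) :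
    HBAlg A a w →ₐ[R] T where
  toFun u := f u.c0 + f u.c1 * x + f u.c2 * b
  map_one' := by simp
  map_zero' := by simp
  map_add' u v := by simp; ring
  map_mul' u v := by
    simp only [mul_c0, mul_c1, mul_c2, map_mul, map_add, map_sub]
    linear_combination (-(f u.c1 * f v.c1)) * h1 - (f u.c1 * f v.c2 + f u.c2 * f v.c1) * h2
      - (f u.c2 * f v.c2) * h3
  commutes' r := by simp

end HBAlg

/-! ### Generalities on polynomial rings -/

lemma aux_linear_ext {k : Type} [Field k] {n : ℕ} {T : Type} [CommRing T] [Algebra k T]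
    (f : MvPolynomial (Fin n) k →ₐ[k] T)
    (L : homogeneousSubmodule (Fin n) k 1 →ₗ[k] T)
    (h : ∀ i, f (X i) = L ⟨X i, isHomogeneous_X k i⟩) (s : homogeneousSubmodule (Fin n) k 1) :
    f s = L s := by
  obtain ⟨s, hs⟩ := s
  have hs' := hs
  rw [homogeneousSubmodule_one_eq_span_X] at hs'
  induction hs' using Submodule.span_induction with
  | mem u hu => obtain ⟨i, rfl⟩ := hu; exact h i
  | zero =>
    have : (⟨0, hs⟩ : homogeneousSubmodule (Fin n) k 1) = 0 := rfl
    rw [this]; simp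
  | add u v hu hv ihu ihv =>
    rw [← homogeneousSubmodule_one_eq_span_X] at hu hv
    have : (⟨u + v, hs⟩ : homogeneousSubmodule (Fin n) k 1) = ⟨u, hu⟩ + ⟨v, hv⟩ := rfl
    rw [this, map_add, ← ihu, ← ihv]; simp
  | smul c u hu ihu =>
    rw [← homogeneousSubmodule_one_eq_span_X] at hu
    have : (⟨c • u, hs⟩ : homogeneousSubmodule (Fin n) k 1) = c • ⟨u, hu⟩ := rfl
    rw [this, map_smul, ← ihu]; simp

lemma aux_finrank_homogeneous {k : Type} [Field k] {τ : Type} [Fintype τ] (d : ℕ) :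
    Module.finrank k (homogeneousSubmodule τ k d) = (Fintype.card τ).multichoose d := by
  classical
  rw [homogeneousSubmodule_eq_finsupp_supported]
  have e : AddMonoidAlgebra.supported k k {m : τ →₀ ℕ | m.degree = d} ≃ₗ[k]
      ({m : τ →₀ ℕ | m.degree = d} →₀ k) := AddMonoidAlgebra.supportedEquivFinsupp _
  rw [e.finrank_eq]
  have e2 : {m : τ →₀ ℕ | m.degree = d} ≃ Sym τ d :=
    (Equiv.subtypeEquivRight (fun m => by
      simp [Finsupp.degree_apply, Finsupp.sum])).trans (Sym.equivNatSum τ d).symm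
  have : Fintype {m : τ →₀ ℕ | m.degree = d} := Fintype.ofEquiv _ e2.symm
  rw [Module.finrank_finsupp_self, Fintype.card_congr e2, Sym.card_sym_eq_multichoose]

lemma aux_hilbert_poly (m : ℕ) :
    (1 - PowerSeries.X) ^ m * PowerSeries.mk (fun d => ((m.multichoose d : ℕ) : ℚ)) = 1 := by
  cases m with
  | zero =>
    ext d
    cases d <;> simp [PowerSeries.coeff_one]
  | succ m =>
    rw [mul_comm]
    refine Eq.trans ?_ (PowerSeries.mk_add_choose_mul_one_sub_pow_eq_one ℚ m)
    congr 2
    ext d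
    rw [Nat.multichoose_eq, show m + 1 + d - 1 = m + d by omega, ← Nat.choose_symm_add]

lemma aux_vars_regular {k : Type} [Field k] {τ : Type} (l : List τ) (hl : l.Nodup) :
    RingTheory.Sequence.IsWeaklyRegular (MvPolynomial τ k)
      (l.map (X : τ → MvPolynomial τ k)) := by
  constructor
  intro i hi
  rw [isSMulRegular_quotient_iff_mem_of_smul_mem]
  intro f hf
  have hid : ∀ g : MvPolynomial τ k,
      g ∈ (Ideal.ofList ((l.map (X : τ → MvPolynomial τ k)).take i) • ⊤ :
        Submodule (MvPolynomial τ k) (MvPolynomial τ k)) ↔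
      g ∈ Ideal.span ((X : τ → MvPolynomial τ k) '' {t | t ∈ l.take i}) := by
    intro g
    rw [smul_eq_mul, Ideal.mul_top, Ideal.ofList, ← List.map_take]
    have : {r | r ∈ List.map (X : τ → MvPolynomial τ k) (l.take i)} = X '' {t | t ∈ l.take i} := by
      ext r; simp only [Set.mem_ofPred_eq, List.mem_map, Set.mem_image]
    rw [this]
  rw [hid] at hf ⊢
  rw [mem_ideal_span_X_image] at hf ⊢
  intro m hm
  have hi' : i < l.length := by simpa using hi
  obtain ⟨t, ht, htm⟩ := hf (m + Finsupp.single l[i] 1) (by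
    rw [mem_support_iff] at hm ⊢
    simpa [mul_comm (X _) f, coeff_mul_X] using hm)
  refine ⟨t, ht, ?_⟩
  have hne : l[i] ≠ t := by
    rintro rfl
    have h1 := List.mem_take_iff_getElem.mp ht
    obtain ⟨j, hj, hje⟩ := h1
    have := (List.Nodup.getElem_inj_iff hl).mp hje
    omega
  simpa [Finsupp.single_apply, hne] using htm

/-! ### The grading on the model algebra -/

/-- Homogeneous polynomials of degree `d - 1` (only `0` for `d = 0`). -/
noncomputable def hbShift (τ k : Type) [Field k] : ℕ → Submodule k (MvPolynomial τ k)
  | 0 => ⊥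
  | d + 1 => homogeneousSubmodule τ k d

lemma hbShift_mul_left {τ k : Type} [Field k] {d e : ℕ} {p q : MvPolynomial τ k}
    (hp : p.IsHomogeneous d) (hq : q ∈ hbShift τ k e) : p * q ∈ hbShift τ k (d + e) := by
  cases e with
  | zero =>
    have : q = 0 := hq
    subst this
    simp
  | succ e => exact hp.mul hq

lemma hbShift_mul_mul {τ k : Type} [Field k] {d e : ℕ} {p q r : MvPolynomial τ k}
    (hr : r.IsHomogeneous 1) (hp : p ∈ hbShift τ k d) (hq : q ∈ hbShift τ k e) :
    r * (p * q) ∈ hbShift τ k (d + e) := by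
  cases d with
  | zero =>
    have : p = 0 := hp
    subst this
    simp
  | succ d =>
    rw [← mul_assoc]
    refine hbShift_mul_left ?_ hq
    rw [add_comm]
    exact hr.mul hp

/-- The grading of the model algebra, with `ξ` and `β` of degree one. -/
noncomputable def hbGr {τ k : Type} [Field k] (a w : MvPolynomial τ k) (d : ℕ) :
    Submodule k (HBAlg (MvPolynomial τ k) a w) :=
  ((homogeneousSubmodule τ k d).prod ((hbShift τ k d).prod (hbShift τ k d))).comap
    (HBAlg.equivProd (R := k)).toLinearMap

lemma mem_hbGr {τ k : Type} [Field k] {a w : MvPolynomial τ k} {d : ℕ}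
    {u : HBAlg (MvPolynomial τ k) a w} :
    u ∈ hbGr a w d ↔ u.c0.IsHomogeneous d ∧ u.c1 ∈ hbShift τ k d ∧ u.c2 ∈ hbShift τ k d :=
  Iff.rfl

lemma hbGr_one {τ k : Type} [Field k] {a w : MvPolynomial τ k} :
    (1 : HBAlg (MvPolynomial τ k) a w) ∈ hbGr a w 0 :=
  mem_hbGr.mpr ⟨isHomogeneous_one _ _, Submodule.zero_mem _, Submodule.zero_mem _⟩

lemma hbGr_mul {τ k : Type} [Field k] {a w : MvPolynomial τ k} (ha : a.IsHomogeneous 1)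
    (hw : w.IsHomogeneous 1) {d e : ℕ} {u v : HBAlg (MvPolynomial τ k) a w}
    (hu : u ∈ hbGr a w d) (hv : v ∈ hbGr a w e) : u * v ∈ hbGr a w (d + e) := by
  rw [mem_hbGr] at hu hv ⊢
  obtain ⟨hu0, hu1, hu2⟩ := hu
  obtain ⟨hv0, hv1, hv2⟩ := hv
  have key : ∀ {p q : MvPolynomial τ k}, p ∈ hbShift τ k d → q.IsHomogeneous e →
      p * q ∈ hbShift τ k (d + e) := by
    intro p q hp hq
    rw [mul_comm, add_comm]
    exact hbShift_mul_left hq hp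
  exact ⟨hu0.mul hv0,
    Submodule.sub_mem _ (Submodule.add_mem _ (hbShift_mul_left hu0 hv1) (key hu1 hv0))
      (hbShift_mul_mul ha hu2 hv2),
    Submodule.sub_mem _ (Submodule.add_mem _ (hbShift_mul_left hu0 hv2) (key hu2 hv0))
      (hbShift_mul_mul hw hu2 hv2)⟩

lemma hbGr_pow {τ k : Type} [Field k] {a w : MvPolynomial τ k} (ha : a.IsHomogeneous 1)
    (hw : w.IsHomogeneous 1) {u : HBAlg (MvPolynomial τ k) a w}
    (hu : u ∈ hbGr a w 1) (d : ℕ) : u ^ d ∈ hbGr a w d := by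
  induction d with
  | zero => rw [pow_zero]; exact hbGr_one
  | succ d ih => rw [pow_succ]; exact hbGr_mul ha hw ih hu

lemma hbGr_aeval {τ k : Type} [Field k] {n : ℕ} {a w : MvPolynomial τ k} (ha : a.IsHomogeneous 1)
    (hw : w.IsHomogeneous 1) (f : MvPolynomial (Fin n) k →ₐ[k] HBAlg (MvPolynomial τ k) a w)
    (hf : ∀ i, f (X i) ∈ hbGr a w 1) {d : ℕ} {s : MvPolynomial (Fin n) k}
    (hs : s.IsHomogeneous d) : f s ∈ hbGr a w d := by
  have key : ∀ m : Fin n →₀ ℕ, f (monomial m 1) ∈ hbGr a w m.degree := by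
    intro m
    induction m using Finsupp.induction_linear with
    | zero =>
      have : (monomial 0 1 : MvPolynomial (Fin n) k) = 1 := rfl
      rw [this, map_one, map_zero]; exact hbGr_one
    | add m m' h h' =>
      have : (monomial (m + m') 1 : MvPolynomial (Fin n) k) = monomial m 1 * monomial m' 1 := by
        rw [monomial_mul, one_mul]
      rw [this, map_mul, map_add]; exact hbGr_mul ha hw h h'
    | single i e =>
      rw [← X_pow_eq_monomial, map_pow, Finsupp.degree_single]
      exact hbGr_pow ha hw (hf i) e
  rw [s.as_sum, map_sum]
  refine Submodule.sum_mem _ fun m hm => ?_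
  have : (monomial m (coeff m s) : MvPolynomial (Fin n) k) = coeff m s • monomial m 1 := by
    rw [smul_monomial, smul_eq_mul, mul_one]
  rw [this, map_smul]
  refine Submodule.smul_mem _ _ ?_
  have h := key m
  have hd : m.degree = d := by
    rw [Finsupp.degree_eq_weight_one]; exact hs (mem_support_iff.mp hm)
  rwa [hd] at h

/-- A product of submodules as a product of modules. -/
def hbProdEquiv {k V W : Type} [Field k] [AddCommGroup V] [AddCommGroup W]
    [Module k V] [Module k W] (p : Submodule k V) (q : Submodule k W) :
    p.prod q ≃ₗ[k] p × q where
  toFun u := (⟨u.1.1, u.2.1⟩, ⟨u.1.2, u.2.2⟩)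
  invFun v := ⟨(v.1.1, v.2.1), v.1.2, v.2.2⟩
  map_add' _ _ := rfl
  map_smul' _ _ := rfl
  left_inv _ := rfl
  right_inv _ := rfl

lemma finrank_prod_submodule {k V W : Type} [Field k] [AddCommGroup V] [AddCommGroup W]
    [Module k V] [Module k W] (p : Submodule k V) (q : Submodule k W)
    [Module.Finite k p] [Module.Finite k q] :
    Module.finrank k (p.prod q) = Module.finrank k p + Module.finrank k q := by
  rw [← Module.finrank_prod]
  exact (hbProdEquiv p q).finrank_eq

lemma hbGr_finrank {τ k : Type} [Field k] [Fintype τ] (a w : MvPolynomial τ k) (d : ℕ) :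
    Module.finrank k (hbGr a w d) = Module.finrank k (homogeneousSubmodule τ k d) +
      2 * Module.finrank k (hbShift τ k d) := by
  have h1 : ∀ d, Module.Finite k (homogeneousSubmodule τ k d) := fun d =>
    Module.Finite.iff_fg.mpr (homogeneousSubmodule_fg τ k d)
  have h2 : Module.Finite k (hbShift τ k d) := by
    cases d with
    | zero => exact inferInstanceAs (Module.Finite k (⊥ : Submodule k _))
    | succ d => exact h1 d
  have h3 : Module.Finite k ((hbShift τ k d).prod (hbShift τ k d)) :=
    Module.Finite.equiv (hbProdEquiv (hbShift τ k d) (hbShift τ k d)).symm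
  have e := (HBAlg.equivProd (R := k) (a := a) (w := w)).ofSubmodule'
    ((homogeneousSubmodule τ k d).prod ((hbShift τ k d).prod (hbShift τ k d)))
  have := e.finrank_eq
  rw [finrank_prod_submodule, finrank_prod_submodule] at this
  rw [two_mul]
  exact this

/-! ### The isomorphism of the quotient with the model algebra -/

theorem hb_core {k : Type} [Field k] {n : ℕ} {τ : Type}
    (e : Module.Basis (Fin 2 ⊕ τ) k (homogeneousSubmodule (Fin n) k 1)) (i j : τ)
    (x b : MvPolynomial (Fin n) k) (hx : x = e (Sum.inl 0)) (hb : b = e (Sum.inl 1))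
    (J : Ideal (MvPolynomial (Fin n) k))
    (hJ : J = Ideal.span {x ^ 2, b * x, e (Sum.inr i) * x + b * (b + e (Sum.inr j))})
    (θ : MvPolynomial τ k →ₐ[k] MvPolynomial (Fin n) k)
    (hθ : θ = aeval (fun t => (e (Sum.inr t) : MvPolynomial (Fin n) k))) :
    ∃ ρ : HBAlg (MvPolynomial τ k) (X i) (X j) ≃ₐ[k] (MvPolynomial (Fin n) k ⧸ J),
      (∀ u, ρ u = Ideal.Quotient.mk J (θ u.c0 + θ u.c1 * x + θ u.c2 * b))
      ∧ ∀ d, ∀ s : MvPolynomial (Fin n) k, s.IsHomogeneous d →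
        ρ.symm (Ideal.Quotient.mk J s) ∈ hbGr (X i) (X j) d := by
  have hθX : ∀ t, θ (X t) = e (Sum.inr t) := by intro t; rw [hθ, aeval_X]
  let ξ : (HBAlg (MvPolynomial τ k) (X i) (X j)) := ⟨0, 1, 0⟩
  let β : (HBAlg (MvPolynomial τ k) (X i) (X j)) := ⟨0, 0, 1⟩
  let L : homogeneousSubmodule (Fin n) k 1 →ₗ[k] (HBAlg (MvPolynomial τ k) (X i) (X j)) :=
    e.constr k (Sum.elim ![ξ, β] (fun t => algebraMap (MvPolynomial τ k) (HBAlg (MvPolynomial τ k) (X i) (X j)) (X t)))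
  let ψ : MvPolynomial (Fin n) k →ₐ[k] (HBAlg (MvPolynomial τ k) (X i) (X j)) := aeval (fun i => L ⟨X i, isHomogeneous_X k i⟩)
  have hψ : ∀ s : homogeneousSubmodule (Fin n) k 1, ψ s = L s :=
    aux_linear_ext ψ L (fun i => by simp [ψ])
  have hψx : ψ x = ξ := by rw [hx, hψ]; simp [L]
  have hψb : ψ b = β := by rw [hb, hψ]; simp [L]
  have hψt : ∀ t, ψ (e (Sum.inr t)) = algebraMap (MvPolynomial τ k) (HBAlg (MvPolynomial τ k) (X i) (X j)) (X t) := by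
    intro t; rw [hψ]; simp [L]
  have hψθ : ∀ p, ψ (θ p) = algebraMap (MvPolynomial τ k) (HBAlg (MvPolynomial τ k) (X i) (X j)) p := by
    intro p
    have : ψ.comp θ = IsScalarTower.toAlgHom k (MvPolynomial τ k) (HBAlg (MvPolynomial τ k) (X i) (X j)) := by
      apply MvPolynomial.algHom_ext
      intro t
      simp only [AlgHom.comp_apply, hθX, hψt]
      rfl
    exact DFunLike.congr_fun this p
  -- relations in the quotient
  have m1 : x ^ 2 ∈ J := by rw [hJ]; exact Ideal.subset_span (by simp)
  have m2 : b * x ∈ J := by rw [hJ]; exact Ideal.subset_span (by simp)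
  have m3 : (e (Sum.inr i) : MvPolynomial (Fin n) k) * x + b * (b + e (Sum.inr j)) ∈ J := by
    rw [hJ]; exact Ideal.subset_span (by simp)
  let f : MvPolynomial τ k →ₐ[k] (MvPolynomial (Fin n) k ⧸ J) := (Ideal.Quotient.mkₐ k J).comp θ
  have r1 : Ideal.Quotient.mk J x * Ideal.Quotient.mk J x = 0 := by
    rw [← map_mul, ← pow_two]; exact Ideal.Quotient.eq_zero_iff_mem.mpr m1
  have r2 : Ideal.Quotient.mk J b * Ideal.Quotient.mk J x = 0 := by
    rw [← map_mul]; exact Ideal.Quotient.eq_zero_iff_mem.mpr m2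
  have r3 : f (X i) * Ideal.Quotient.mk J x + Ideal.Quotient.mk J b * Ideal.Quotient.mk J b
      + f (X j) * Ideal.Quotient.mk J b = 0 := by
    have h := Ideal.Quotient.eq_zero_iff_mem.mpr m3
    have hi : f (X i) = Ideal.Quotient.mk J (e (Sum.inr i)) := by
      change Ideal.Quotient.mk J (θ (X i)) = _; rw [hθX]
    have hj : f (X j) = Ideal.Quotient.mk J (e (Sum.inr j)) := by
      change Ideal.Quotient.mk J (θ (X j)) = _; rw [hθX]
    rw [hi, hj]
    simp only [map_add, map_mul] at h
    linear_combination h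
  let ρ₀ : (HBAlg (MvPolynomial τ k) (X i) (X j)) →ₐ[k] (MvPolynomial (Fin n) k ⧸ J) := HBAlg.lift f _ _ r1 r2 r3
  have hρ₀ : ∀ u, ρ₀ u = Ideal.Quotient.mk J (θ u.c0 + θ u.c1 * x + θ u.c2 * b) := by
    intro u
    simp only [map_add, map_mul]
    rfl
  have hJψ : ∀ s ∈ J, ψ s = 0 := by
    intro s hs
    have : J ≤ RingHom.ker ψ.toRingHom := by
      rw [hJ, Ideal.span_le]
      rintro s hs
      simp only [Set.mem_insert_iff, Set.mem_singleton_iff] at hs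
      rcases hs with rfl | rfl | rfl
      · change ψ (x ^ 2) = 0
        rw [map_pow, hψx, pow_two]; apply HBAlg.ext <;> simp [ξ]
      · change ψ (b * x) = 0
        rw [map_mul, hψx, hψb]; apply HBAlg.ext <;> simp [ξ, β]
      · change ψ (e (Sum.inr i) * x + b * (b + e (Sum.inr j))) = 0
        simp only [map_add, map_mul, hψx, hψb, hψt]; apply HBAlg.ext <;> simp [ξ, β]
    exact this hs
  let ψ' : (MvPolynomial (Fin n) k ⧸ J) →ₐ[k] (HBAlg (MvPolynomial τ k) (X i) (X j)) := Ideal.Quotient.liftₐ J ψ hJψ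
  have hψ' : ∀ s, ψ' (Ideal.Quotient.mk J s) = ψ s := fun s => rfl
  have c1 : ρ₀.comp ψ' = AlgHom.id k _ := by
    apply Ideal.Quotient.algHom_ext
    apply MvPolynomial.algHom_ext
    intro l
    change ρ₀ (ψ (X l)) = Ideal.Quotient.mk J (X l)
    have hlin : ρ₀.toLinearMap.comp L =
        (Ideal.Quotient.mkₐ k J).toLinearMap.comp (Submodule.subtype _) := by
      apply e.ext
      rintro (t | t)
      · revert t
        refine Fin.forall_fin_two.mpr ⟨?_, ?_⟩
        · change ρ₀ (L (e (Sum.inl 0))) = Ideal.Quotient.mk J (e (Sum.inl 0))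
          rw [← hψ, ← hx, hψx, hρ₀]; simp [ξ]
        · change ρ₀ (L (e (Sum.inl 1))) = Ideal.Quotient.mk J (e (Sum.inl 1))
          rw [← hψ, ← hb, hψb, hρ₀]; simp [β]
      · change ρ₀ (L (e (Sum.inr t))) = Ideal.Quotient.mk J (e (Sum.inr t))
        rw [← hψ, hψt, hρ₀]; simp [hθX]
    have := DFunLike.congr_fun hlin ⟨X l, isHomogeneous_X k l⟩
    rw [show ψ (X l) = L ⟨X l, isHomogeneous_X k l⟩ from hψ ⟨X l, isHomogeneous_X k l⟩]
    exact this
  have c2 : ψ'.comp ρ₀ = AlgHom.id k _ := by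
    apply AlgHom.ext
    intro u
    change ψ' (ρ₀ u) = u
    rw [hρ₀, hψ']
    simp only [map_add, map_mul, hψθ, hψx, hψb]
    apply HBAlg.ext <;> simp [ξ, β]
  refine ⟨AlgEquiv.ofAlgHom ρ₀ ψ' c1 c2, hρ₀, ?_⟩
  intro d s hs
  change ψ s ∈ _
  refine hbGr_aeval (isHomogeneous_X _ _) (isHomogeneous_X _ _) ψ ?_ hs
  intro l
  rw [show ψ (X l) = L ⟨X l, isHomogeneous_X k l⟩ from hψ ⟨X l, isHomogeneous_X k l⟩]
  have : LinearMap.range L ≤ hbGr (X i) (X j) 1 := by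
    rw [Module.Basis.constr_range, Submodule.span_le]
    rintro _ ⟨t | t, rfl⟩
    · fin_cases t
      · exact mem_hbGr.mpr ⟨isHomogeneous_zero _ _ _, isHomogeneous_one _ _, Submodule.zero_mem _⟩
      · exact mem_hbGr.mpr ⟨isHomogeneous_zero _ _ _, Submodule.zero_mem _, isHomogeneous_one _ _⟩
    · exact mem_hbGr.mpr ⟨isHomogeneous_X _ _, Submodule.zero_mem _, Submodule.zero_mem _⟩
  exact this ⟨_, rfl⟩

/-! ### Consequences of the isomorphism -/

lemma hb_theta_homogeneous {k : Type} [Field k] {n : ℕ} {τ : Type}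
    (v : τ → MvPolynomial (Fin n) k) (hv : ∀ t, (v t).IsHomogeneous 1) {d : ℕ}
    {p : MvPolynomial τ k} (hp : p.IsHomogeneous d) : (aeval v p).IsHomogeneous d := by
  have := hp.aeval v hv
  rwa [one_mul] at this

theorem hb_hilbert {k : Type} [Field k] {n : ℕ} {τ : Type} [Fintype τ]
    (e : Module.Basis (Fin 2 ⊕ τ) k (homogeneousSubmodule (Fin n) k 1)) (i j : τ)
    (x b : MvPolynomial (Fin n) k) (hx : x = e (Sum.inl 0)) (hb : b = e (Sum.inl 1))
    (J : Ideal (MvPolynomial (Fin n) k))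
    (hJ : J = Ideal.span {x ^ 2, b * x, e (Sum.inr i) * x + b * (b + e (Sum.inr j))}) (d : ℕ) :
    hilbertFn J d = Module.finrank k (homogeneousSubmodule τ k d) +
      2 * Module.finrank k (hbShift τ k d) := by
  obtain ⟨ρ, hρ, hd⟩ := hb_core e i j x b hx hb J hJ _ rfl
  have hmap : (homogeneousSubmodule (Fin n) k d).map (Ideal.Quotient.mkₐ k J).toLinearMap =
      (hbGr (X i) (X j) d).map ρ.toLinearEquiv.toLinearMap := by
    apply le_antisymm
    · rintro _ ⟨s, hs, rfl⟩
      refine ⟨_, hd d s hs, ?_⟩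
      exact ρ.apply_symm_apply _
    · rintro _ ⟨u, hu, rfl⟩
      obtain ⟨h0, h1, h2⟩ := mem_hbGr.mp hu
      refine ⟨_, ?_, (hρ u).symm⟩
      have hv : ∀ t, (e (Sum.inr t) : MvPolynomial (Fin n) k).IsHomogeneous 1 :=
        fun t => (e (Sum.inr t)).2
      have key : ∀ (q : MvPolynomial τ k) (z : MvPolynomial (Fin n) k), q ∈ hbShift τ k d →
          z.IsHomogeneous 1 →
          (aeval (fun t => (e (Sum.inr t) : MvPolynomial (Fin n) k)) q * z).IsHomogeneous d := by
        intro q z hq hz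
        cases d with
        | zero =>
          have : q = 0 := hq
          subst this
          rw [map_zero, zero_mul]; exact isHomogeneous_zero _ _ _
        | succ d => exact (hb_theta_homogeneous _ hv hq).mul hz
      refine ((hb_theta_homogeneous _ hv h0).add (key _ _ h1 ?_)).add (key _ _ h2 ?_)
      · rw [hx]; exact (e (Sum.inl 0)).2
      · rw [hb]; exact (e (Sum.inl 1)).2
  rw [hilbertFn, hmap, ← hbGr_finrank (X i) (X j) d]
  exact (ρ.toLinearEquiv.submoduleMap (hbGr (X i) (X j) d)).finrank_eq.symm

theorem hb_series {k : Type} [Field k] {n : ℕ} {τ : Type} [Fintype τ]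
    (e : Module.Basis (Fin 2 ⊕ τ) k (homogeneousSubmodule (Fin n) k 1)) (i j : τ)
    (x b : MvPolynomial (Fin n) k) (hx : x = e (Sum.inl 0)) (hb : b = e (Sum.inl 1))
    (J : Ideal (MvPolynomial (Fin n) k))
    (hJ : J = Ideal.span {x ^ 2, b * x, e (Sum.inr i) * x + b * (b + e (Sum.inr j))}) :
    ∃ Q : Polynomial ℚ,
      (1 - PowerSeries.X) ^ (Fintype.card τ) * hilbertSeries J =
        PowerSeries.mk (fun d => Q.coeff d) ∧ Q.eval 1 = 3 := by
  refine ⟨1 + Polynomial.C 2 * Polynomial.X, ?_, by simp; norm_num⟩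
  have h1 : hilbertSeries J = (1 + PowerSeries.C (2 : ℚ) * PowerSeries.X) *
      PowerSeries.mk (fun d => (((Fintype.card τ).multichoose d : ℕ) : ℚ)) := by
    ext d
    rw [hilbertSeries, PowerSeries.coeff_mk, hb_hilbert e i j x b hx hb J hJ d,
      aux_finrank_homogeneous, add_mul, one_mul, map_add, PowerSeries.coeff_mk, mul_assoc,
      PowerSeries.coeff_C_mul]
    cases d with
    | zero =>
      have : Module.finrank k (hbShift τ k 0) = 0 := finrank_bot k _
      simp [this]
    | succ d =>
      have : Module.finrank k (hbShift τ k (d + 1)) = (Fintype.card τ).multichoose d :=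
        aux_finrank_homogeneous d
      rw [this, PowerSeries.coeff_succ_X_mul, PowerSeries.coeff_mk]
      push_cast
      ring
  rw [h1, mul_left_comm, aux_hilbert_poly, mul_one]
  have : (PowerSeries.mk fun d => (1 + Polynomial.C 2 * Polynomial.X : Polynomial ℚ).coeff d) =
      ((1 + Polynomial.C 2 * Polynomial.X : Polynomial ℚ) : PowerSeries ℚ) := by
    ext d
    rw [PowerSeries.coeff_mk, Polynomial.coeff_coe]
  rw [this, Polynomial.coe_add, Polynomial.coe_mul, Polynomial.coe_one, Polynomial.coe_C,
    Polynomial.coe_X]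

/-- Transport of weakly regular sequences along a free extension. -/
lemma hb_regular_transport {A B S T : Type} [CommRing A] [CommRing B] [CommRing S] [CommRing T]
    [Algebra A B] [Module.Free A B] [Algebra S T] (θ : A →+* S) (ρ : B ≃+* T)
    (h : ∀ p, ρ (algebraMap A B p) = algebraMap S T (θ p)) (l : List A)
    (hl : RingTheory.Sequence.IsWeaklyRegular A l) :
    RingTheory.Sequence.IsWeaklyRegular T (l.map θ) := by
  let _ : Algebra A T := ((algebraMap S T).comp θ).toAlgebra
  let E : B ≃ₐ[A] T := AlgEquiv.ofRingEquiv (f := ρ) h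
  have hfree : Module.Free A T := Module.Free.of_equiv E.toLinearEquiv
  have h := hl.of_flat (S := T)
  rw [← RingTheory.Sequence.isWeaklyRegular_map_algebraMap_iff T T (l.map θ), List.map_map]
  exact h

/-- Every element of an ideal generated by elements without constant term has none. -/
lemma hb_span_ne_top {k : Type} [Field k] {n : ℕ} (I : Ideal (MvPolynomial (Fin n) k))
    (hI : I ≤ RingHom.ker (constantCoeff (σ := Fin n) (R := k))) : I ≠ ⊤ := by
  rintro rfl
  have : (1 : MvPolynomial (Fin n) k) ∈ RingHom.ker (constantCoeff (σ := Fin n) (R := k)) :=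
    hI trivial
  rw [RingHom.mem_ker, map_one] at this
  exact one_ne_zero this

lemma hb_constantCoeff {k : Type} [Field k] {n : ℕ} {s : MvPolynomial (Fin n) k}
    (hs : s.IsHomogeneous 1) : constantCoeff s = 0 := by
  by_contra h
  have := hs (d := 0) h
  simp at this

theorem hb_cm {k : Type} [Field k] {n : ℕ} {τ : Type} [Fintype τ]
    (e : Module.Basis (Fin 2 ⊕ τ) k (homogeneousSubmodule (Fin n) k 1)) (i j : τ)
    (x b : MvPolynomial (Fin n) k) (hx : x = e (Sum.inl 0)) (hb : b = e (Sum.inl 1))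
    (J : Ideal (MvPolynomial (Fin n) k))
    (hJ : J = Ideal.span {x ^ 2, b * x, e (Sum.inr i) * x + b * (b + e (Sum.inr j))})
    (hcard : Fintype.card τ = n - 2) : IsGradedCMQuotient J 2 := by
  obtain ⟨θ, hθ⟩ : ∃ θ : MvPolynomial τ k →ₐ[k] MvPolynomial (Fin n) k,
    θ = aeval (fun t => (e (Sum.inr t) : MvPolynomial (Fin n) k)) := ⟨_, rfl⟩
  obtain ⟨ρ, hρ, -⟩ := hb_core e i j x b hx hb J hJ θ hθ
  have hθX : ∀ t, θ (X t) = e (Sum.inr t) := by intro t; rw [hθ, aeval_X]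
  set l : List τ := (Finset.univ : Finset τ).toList with hl
  have hcx : constantCoeff x = 0 := by rw [hx]; exact hb_constantCoeff (e (Sum.inl 0)).2
  have hcb : constantCoeff b = 0 := by rw [hb]; exact hb_constantCoeff (e (Sum.inl 1)).2
  have hct : ∀ t, constantCoeff (e (Sum.inr t) : MvPolynomial (Fin n) k) = 0 :=
    fun t => hb_constantCoeff (e (Sum.inr t)).2
  refine ⟨(l.map X).map θ, ?_, ?_, ⟨?_, ?_⟩, ?_⟩
  · rw [List.length_map, List.length_map, hl, Finset.length_toList, Finset.card_univ, hcard]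
  · intro f hf
    rw [List.map_map, List.mem_map] at hf
    obtain ⟨t, -, rfl⟩ := hf
    refine ⟨0, ?_⟩
    rw [Function.comp_apply, hθX]
    exact (e (Sum.inr t)).2
  · refine hb_regular_transport (B := HBAlg (MvPolynomial τ k) (X i) (X j))
      (θ : MvPolynomial τ k →+* MvPolynomial (Fin n) k)
      (ρ : HBAlg (MvPolynomial τ k) (X i) (X j) ≃+* (MvPolynomial (Fin n) k ⧸ J)) ?_ (l.map X)
      (aux_vars_regular (k := k) l (Finset.nodup_toList _))
    intro p
    refine (hρ _).trans ?_
    rw [HBAlg.algebraMap_c0, HBAlg.algebraMap_c1, HBAlg.algebraMap_c2, map_zero, zero_mul,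
      zero_mul, add_zero, add_zero]
    rfl
  · intro h
    have h1 : (1 : MvPolynomial (Fin n) k ⧸ J) ∈
        (Ideal.ofList ((l.map X).map θ) • ⊤ :
          Submodule (MvPolynomial (Fin n) k) (MvPolynomial (Fin n) k ⧸ J)) := h ▸ trivial
    have hJ0 : ∀ s ∈ J, constantCoeff s = 0 := by
      have : J ≤ RingHom.ker (constantCoeff (σ := Fin n) (R := k)) := by
        rw [hJ, Ideal.span_le]
        rintro s hs
        simp only [Set.mem_insert_iff, Set.mem_singleton_iff] at hs
        rcases hs with rfl | rfl | rfl <;> simp [RingHom.mem_ker, hcx, hcb, hct]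
      exact this
    let g : (MvPolynomial (Fin n) k ⧸ J) →+* k := Ideal.Quotient.lift J constantCoeff hJ0
    have hg : ∀ z ∈ (Ideal.ofList ((l.map X).map θ) • ⊤ :
          Submodule (MvPolynomial (Fin n) k) (MvPolynomial (Fin n) k ⧸ J)), g z = 0 := by
      intro z hz
      refine Submodule.smul_induction_on hz ?_ ?_
      · intro r hr m _
        have hr' : Ideal.ofList ((l.map X).map θ) ≤
            RingHom.ker (constantCoeff (σ := Fin n) (R := k)) := by
          rw [Ideal.ofList, Ideal.span_le]
          intro s hs
          have hs : s ∈ (l.map X).map θ := hs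
          rw [List.map_map, List.mem_map] at hs
          obtain ⟨t, -, rfl⟩ := hs
          rw [Function.comp_apply, hθX]
          exact hct t
        have : g (r • m) = constantCoeff r * g m := by
          obtain ⟨m', rfl⟩ := Ideal.Quotient.mk_surjective m
          change constantCoeff (r * m') = constantCoeff r * constantCoeff m'
          exact map_mul _ _ _
        rw [this, show constantCoeff r = 0 from hr' hr, zero_mul]
      · intro u v hu hv
        rw [map_add, hu, hv, add_zero]
    have := hg 1 h1
    rw [map_one] at this
    exact one_ne_zero this
  · set I := J + Ideal.span {f | f ∈ (l.map X).map θ} with hI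
    let q := Ideal.Quotient.mkₐ k I
    have hqt : ∀ p, q (θ p) = algebraMap k _ (constantCoeff p) := by
      intro p
      have : q.comp θ = (Algebra.ofId k _).comp (aeval (fun _ : τ => (0 : k))) := by
        apply MvPolynomial.algHom_ext
        intro t
        rw [AlgHom.comp_apply, AlgHom.comp_apply, aeval_X, map_zero]
        refine Ideal.Quotient.eq_zero_iff_mem.mpr (Ideal.mem_sup_right (Ideal.subset_span ?_))
        change θ (X t) ∈ (l.map X).map θ
        exact List.mem_map_of_mem (List.mem_map_of_mem (by simp [hl]))
      have h := DFunLike.congr_fun this p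
      rw [AlgHom.comp_apply, AlgHom.comp_apply] at h
      rw [h]
      have : aeval (fun _ : τ => (0 : k)) p = constantCoeff p := by
        simp
      rw [this]; rfl
    let F' : (k × k × k) →ₗ[k] MvPolynomial (Fin n) k :=
      (Algebra.linearMap k _).coprod
        ((LinearMap.toSpanSingleton k _ x).coprod (LinearMap.toSpanSingleton k _ b))
    let F : (k × k × k) →ₗ[k] (MvPolynomial (Fin n) k ⧸ I) := q.toLinearMap.comp F'
    refine Module.Finite.of_surjective F ?_
    intro z
    obtain ⟨s, rfl⟩ := Ideal.Quotient.mk_surjective z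
    obtain ⟨u, hu⟩ := ρ.surjective (Ideal.Quotient.mk J s)
    rw [hρ, Ideal.Quotient.eq] at hu
    have hu' : q (θ u.c0 + θ u.c1 * x + θ u.c2 * b) = q s :=
      Ideal.Quotient.eq.mpr (Ideal.mem_sup_left hu)
    refine ⟨(constantCoeff u.c0, constantCoeff u.c1, constantCoeff u.c2), ?_⟩
    change _ = q s
    rw [← hu']
    simp only [map_add, map_mul, hqt]
    change q (C (constantCoeff u.c0) + (constantCoeff u.c1 • x + constantCoeff u.c2 • b)) = _
    rw [MvPolynomial.smul_eq_C_mul, MvPolynomial.smul_eq_C_mul, map_add, map_add, map_mul,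
      map_mul, ← add_assoc]
    rfl
/-! ### Heights and linear independence -/

lemma hb_idealHeight_le {S : Type} [CommRing S] [IsNoetherianRing S] (I : Ideal S)
    (s : Finset S) (hs : I ≤ Ideal.span (s : Set S)) (hne : Ideal.span (s : Set S) ≠ ⊤) :
    idealHeight I ≤ s.card := by
  obtain ⟨p, hp⟩ := Ideal.nonempty_minimalPrimes hne
  have hpp : p.IsPrime := hp.1.1
  have h := Ideal.height_le_card_of_mem_minimalPrimes_span_finset hp
  refine le_trans (iInf₂_le (⟨p, hpp⟩ : PrimeSpectrum S) (hs.trans hp.1.2)) ?_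
  rw [← PrimeSpectrum.height_eq_orderHeight]
  exact h

lemma hb_exists_small_span {k V : Type} [Field k] [AddCommGroup V] [Module k V] {m : ℕ}
    (v : Fin m → V) (hli : ¬ LinearIndependent k v) :
    ∃ s : Finset V, s.card < m ∧ (∀ i, v i ∈ Submodule.span k (s : Set V)) := by
  classical
  have hlt : Module.finrank k (Submodule.span k (Set.range v)) < m := by
    have h1 := finrank_range_le_card (R := k) v
    rw [Fintype.card_fin] at h1
    rcases h1.lt_or_eq with h2 | h2
    · exact h2
    · exact absurd (linearIndependent_iff_card_eq_finrank_span.mpr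
        (by rw [Fintype.card_fin]; exact h2.symm)) hli
  have hfin : Module.Finite k (Submodule.span k (Set.range v)) :=
    Module.Finite.span_of_finite k (Set.finite_range v)
  let B := Module.finBasis k (Submodule.span k (Set.range v))
  refine ⟨Finset.univ.image fun r => (B r : V),
    lt_of_le_of_lt (Finset.card_image_le.trans (by simp)) hlt, fun i => ?_⟩
  have h1 := congrArg Subtype.val (B.sum_repr ⟨v i, Submodule.subset_span ⟨i, rfl⟩⟩)
  rw [Submodule.coe_sum] at h1
  rw [← show _ = v i from h1]
  refine Submodule.sum_mem _ fun r _ => ?_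
  rw [Submodule.coe_smul]
  exact Submodule.smul_mem _ _ (Submodule.subset_span (by simp))

lemma hb_linearIndependent {k : Type} [Field k] {n : ℕ} {m : ℕ}
    (v : Fin m → homogeneousSubmodule (Fin n) k 1) (I : Ideal (MvPolynomial (Fin n) k))
    (hI : I ≤ Ideal.span (Set.range fun i => (v i : MvPolynomial (Fin n) k)))
    (h : idealHeight I = m) : LinearIndependent k v := by
  classical
  by_contra hli
  obtain ⟨t, htc, ht⟩ := hb_exists_small_span v hli
  let s : Finset (MvPolynomial (Fin n) k) := t.image fun r : homogeneousSubmodule (Fin n) k 1 => (r : MvPolynomial (Fin n) k)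
  have hs : Ideal.span (Set.range fun i => (v i : MvPolynomial (Fin n) k)) ≤
      Ideal.span (s : Set (MvPolynomial (Fin n) k)) := by
    rw [Ideal.span_le]
    rintro _ ⟨i, rfl⟩
    change (v i : MvPolynomial (Fin n) k) ∈ _
    refine Submodule.span_induction (p := fun (z : homogeneousSubmodule (Fin n) k 1) _ => (z : MvPolynomial (Fin n) k) ∈
      Ideal.span (s : Set (MvPolynomial (Fin n) k))) ?_ ?_ ?_ ?_ (ht i)
    · intro z hz
      exact Ideal.subset_span (by
        rw [Finset.mem_coe]; exact Finset.mem_image_of_mem _ hz)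
    · exact Ideal.zero_mem _
    · intro z w _ _ hz hw
      exact Ideal.add_mem _ hz hw
    · intro c z _ hz
      rw [Submodule.coe_smul, MvPolynomial.smul_eq_C_mul]
      exact Ideal.mul_mem_left _ _ hz
  have hne : Ideal.span (s : Set (MvPolynomial (Fin n) k)) ≠ ⊤ := by
    apply hb_span_ne_top
    rw [Ideal.span_le]
    intro z hz
    rw [Finset.mem_coe, Finset.mem_image] at hz
    obtain ⟨r, -, rfl⟩ := hz
    exact hb_constantCoeff r.2
  have h3 := hb_idealHeight_le I s (hI.trans hs) hne
  have h4 : s.card ≤ t.card := Finset.card_image_le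
  rw [h] at h3
  have : m ≤ s.card := by exact_mod_cast h3
  omega

lemma hb_not_dvd {k : Type} [Field k] {n : ℕ} {x z : MvPolynomial (Fin n) k}
    (hx : x.IsHomogeneous 1) (hz : z.IsHomogeneous 1) (hx0 : x ≠ 0) (hz0 : z ≠ 0)
    (h : ∀ c : k, z ≠ c • x) : ¬ x ∣ z := by
  rintro ⟨w, rfl⟩
  have hw0 : w ≠ 0 := right_ne_zero_of_mul hz0
  have h1 := totalDegree_mul_of_isDomain hx0 hw0
  rw [hx.totalDegree hx0, hz.totalDegree hz0] at h1
  have h2 : w.totalDegree = 0 := by omega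
  rw [totalDegree_eq_zero_iff_eq_C] at h2
  apply h (coeff 0 w)
  rw [MvPolynomial.smul_eq_C_mul, mul_comm, ← h2]

lemma hb_prime {k : Type} [Field k] {n : ℕ} {x : MvPolynomial (Fin n) k}
    (hx : x.IsHomogeneous 1) (hx0 : x ≠ 0) : Prime x := by
  apply Irreducible.prime
  refine MvPolynomial.irreducible_of_totalDegree_eq_one (hx.totalDegree hx0) ?_
  intro c hc
  rw [isUnit_iff_ne_zero]
  rintro rfl
  apply hx0
  ext d
  rw [coeff_zero]
  exact zero_dvd_iff.mp (hc d)

theorem hb_height {k : Type} [Field k] {n : ℕ} {x y a b : MvPolynomial (Fin n) k}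
    (hx : x.IsHomogeneous 1) (hy : y.IsHomogeneous 1) (hb : b.IsHomogeneous 1)
    (hx0 : x ≠ 0) (hy0 : y ≠ 0) (hb0 : b ≠ 0)
    (hxy : ∀ c : k, y ≠ c • x) (hxb : ∀ c : k, b ≠ c • x) :
    idealHeight (Ideal.span {x ^ 2, b * x, a * x + b * y}) = 2 := by
  classical
  apply le_antisymm
  · refine (hb_idealHeight_le _ ({x, y} : Finset _) ?_ ?_).trans ?_
    · have h1 : x ∈ Ideal.span ((({x, y} : Finset (MvPolynomial (Fin n) k)) :
          Set (MvPolynomial (Fin n) k))) := Ideal.subset_span (by simp)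
      have h2 : y ∈ Ideal.span ((({x, y} : Finset (MvPolynomial (Fin n) k)) :
          Set (MvPolynomial (Fin n) k))) := Ideal.subset_span (by simp)
      rw [Ideal.span_le]
      intro z hz
      simp only [Set.mem_insert_iff, Set.mem_singleton_iff] at hz
      rcases hz with rfl | rfl | rfl
      · exact Ideal.pow_mem_of_mem _ h1 2 (by norm_num)
      · exact Ideal.mul_mem_left _ _ h1
      · exact Ideal.add_mem _ (Ideal.mul_mem_left _ _ h1) (Ideal.mul_mem_left _ _ h2)
    · apply hb_span_ne_top
      rw [Ideal.span_le]
      intro z hz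
      simp only [Finset.coe_insert, Finset.coe_singleton, Set.mem_insert_iff,
        Set.mem_singleton_iff] at hz
      rcases hz with rfl | rfl
      · exact hb_constantCoeff hx
      · exact hb_constantCoeff hy
    · exact_mod_cast Finset.card_le_two
  · refine le_iInf₂ fun p hp => ?_
    have hp : Ideal.span {x ^ 2, b * x, a * x + b * y} ≤ p.asIdeal := hp
    have hpp := p.isPrime
    have hxp : x ∈ p.asIdeal := hpp.mem_of_pow_mem 2 (hp (Ideal.subset_span (by simp)))
    have hby : b * y ∈ p.asIdeal := by
      have h : a * x + b * y ∈ p.asIdeal := hp (Ideal.subset_span (by simp))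
      exact (Ideal.add_mem_iff_right _ (Ideal.mul_mem_left _ _ hxp)).mp h
    have hxP : (Ideal.span {x}).IsPrime :=
      (Ideal.span_singleton_prime hx0).mpr (hb_prime hx hx0)
    have hle : Ideal.span {x} ≤ p.asIdeal := by
      rw [Ideal.span_le]; simpa using hxp
    have hlt : Ideal.span {x} < p.asIdeal := by
      refine lt_of_le_of_ne hle fun heq => ?_
      rcases hpp.mem_or_mem hby with h | h
      · rw [← heq, Ideal.mem_span_singleton] at h
        exact hb_not_dvd hx hb hx0 hb0 hxb h
      · rw [← heq, Ideal.mem_span_singleton] at h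
        exact hb_not_dvd hx hy hx0 hy0 hxy h
    have hlt0 : (⊥ : Ideal (MvPolynomial (Fin n) k)) < Ideal.span {x} := by
      rw [bot_lt_iff_ne_bot, Ne, Ideal.span_singleton_eq_bot]; exact hx0
    have hbot : (⊥ : Ideal (MvPolynomial (Fin n) k)).IsPrime := Ideal.isPrime_bot
    have h1 := Ideal.height_add_one_le_of_lt_of_isPrime hlt0
    have h2 := Ideal.height_add_one_le_of_lt_of_isPrime hlt
    rw [← PrimeSpectrum.height_eq_orderHeight]
    calc (2 : ℕ∞) = 0 + 1 + 1 := by norm_num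
      _ ≤ (⊥ : Ideal (MvPolynomial (Fin n) k)).height + 1 + 1 := by gcongr; exact zero_le
      _ ≤ (Ideal.span {x}).height + 1 := by gcongr
      _ ≤ _ := h2
/-- Extension of a linearly independent family of four linear forms to a basis. -/
lemma hb_exists_basis {k : Type} [Field k] {n : ℕ}
    (w : Fin 2 ⊕ Fin 2 → homogeneousSubmodule (Fin n) k 1) (hw : LinearIndependent k w) :
    ∃ (ι : Type) (_ : Fintype ι)
      (e : Module.Basis (Fin 2 ⊕ (Fin 2 ⊕ ι)) k (homogeneousSubmodule (Fin n) k 1)),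
      (∀ r, e (Sum.inl r) = w (Sum.inl r)) ∧ (∀ r, e (Sum.inr (Sum.inl r)) = w (Sum.inr r)) ∧
      Fintype.card (Fin 2 ⊕ ι) = n - 2 := by
  classical
  have hfr : Module.finrank k (homogeneousSubmodule (Fin n) k 1) = n := by
    rw [aux_finrank_homogeneous, Fintype.card_fin, Nat.multichoose_one_right]
  have hpos : 0 < n := by
    rcases Nat.eq_zero_or_pos n with h | h
    · exfalso
      subst h
      have h0 : (w (Sum.inl 0) : MvPolynomial (Fin 0) k) = 0 := by
        have h1 := hb_constantCoeff (w (Sum.inl 0)).2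
        rw [← C_inj (σ := Fin 0), map_zero] at h1
        rw [← h1, eq_C_of_isEmpty (w (Sum.inl 0) : MvPolynomial (Fin 0) k)]
        simp
      exact hw.ne_zero (Sum.inl 0) (Subtype.ext h0)
    · exact h
  have hfin : Module.Finite k (homogeneousSubmodule (Fin n) k 1) :=
    Module.finite_of_finrank_pos (by omega)
  let B := Module.Basis.sumExtend hw
  have : Finite ((Fin 2 ⊕ Fin 2) ⊕ Module.Basis.sumExtendIndex hw) :=
    Module.Finite.finite_basis B
  have hι : Finite (Module.Basis.sumExtendIndex hw) :=
    Finite.of_injective (Sum.inr : _ → (Fin 2 ⊕ Fin 2) ⊕ Module.Basis.sumExtendIndex hw)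
      Sum.inr_injective
  have hF : Fintype (Module.Basis.sumExtendIndex hw) := Fintype.ofFinite _
  have hB : ∀ r, B (Sum.inl r) = w r := by
    intro r
    simp only [B, Module.Basis.sumExtend, Module.Basis.reindex_apply, Equiv.symm_symm]
    rw [Module.Basis.extend_apply_self]
    rfl
  let e := B.reindex (Equiv.sumAssoc (Fin 2) (Fin 2) (Module.Basis.sumExtendIndex hw))
  refine ⟨Module.Basis.sumExtendIndex hw, hF, e, ?_, ?_, ?_⟩
  · intro r
    rw [Module.Basis.reindex_apply]; exact hB (Sum.inl r)
  · intro r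
    rw [Module.Basis.reindex_apply]; exact hB (Sum.inr r)
  · have h := Module.finrank_eq_card_basis e
    rw [hfr, Fintype.card_sum, Fintype.card_fin] at h
    omega

/-- Let `x, y, b₃, b₄, a₃` be linear forms with `ht(x, b₃, b₄) = 3` and `ht(x, y, a₃, b₃) = 4`,
and set `q₃ = a₃x + b₃y`, `J = (x², b₃x, q₃)`.  Then `J = I₂(M)` for the matrix
`M = [[b₃, −x, 0], [a₃, y, −x]]`, `J` is a Cohen–Macaulay ideal of height `2`, and the
multiplicity `e(S/J) = 3` (the numerator `Q(t)` of the Hilbert series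
`H_{S/J}(t) = Q(t)/(1-t)^{n-2}` satisfies `Q(1) = 3`). -/
theorem hilbert_burch_case_a {k : Type} [Field k] {n : ℕ}
    (x y a₃ b₃ b₄ : MvPolynomial (Fin n) k)
    (hx : x ∈ homogeneousSubmodule (Fin n) k 1) (hy : y ∈ homogeneousSubmodule (Fin n) k 1)
    (ha₃ : a₃ ∈ homogeneousSubmodule (Fin n) k 1)
    (hb₃ : b₃ ∈ homogeneousSubmodule (Fin n) k 1) (hb₄ : b₄ ∈ homogeneousSubmodule (Fin n) k 1)
    (h₁ : idealHeight (Ideal.span {x, b₃, b₄}) = 3)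
    (h₂ : idealHeight (Ideal.span {x, y, a₃, b₃}) = 4)
    (q₃ : MvPolynomial (Fin n) k) (hq₃ : q₃ = a₃ * x + b₃ * y)
    (J : Ideal (MvPolynomial (Fin n) k)) (hJ : J = Ideal.span {x ^ 2, b₃ * x, q₃}) :
    J = Ideal.span {b₃ * y - (-x) * a₃, b₃ * (-x) - 0 * a₃, (-x) * (-x) - 0 * y} ∧
    idealHeight J = 2 ∧
    IsGradedCMQuotient J 2 ∧
    ∃ Q : Polynomial ℚ,
      (1 - PowerSeries.X) ^ (n - 2) * hilbertSeries J =
        PowerSeries.mk (fun d => Q.coeff d) ∧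
      Q.eval 1 = 3 := by
  have hv : LinearIndependent k
      (![⟨x, hx⟩, ⟨y, hy⟩, ⟨a₃, ha₃⟩, ⟨b₃, hb₃⟩] : Fin 4 → homogeneousSubmodule (Fin n) k 1) := by
    refine hb_linearIndependent _ _ ?_ h₂
    rw [Ideal.span_le]
    intro z hz
    simp only [Set.mem_insert_iff, Set.mem_singleton_iff] at hz
    rcases hz with rfl | rfl | rfl | rfl
    · exact Ideal.subset_span ⟨0, rfl⟩
    · exact Ideal.subset_span ⟨1, rfl⟩
    · exact Ideal.subset_span ⟨2, rfl⟩
    · exact Ideal.subset_span ⟨3, rfl⟩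
  have hrel : ∀ c₀ c₁ c₂ c₃ : k, c₀ • x + c₁ • y + c₂ • a₃ + c₃ • b₃ = 0 →
      c₀ = 0 ∧ c₁ = 0 ∧ c₂ = 0 ∧ c₃ = 0 := by
    intro c₀ c₁ c₂ c₃ h
    have h1 := Fintype.linearIndependent_iff.mp hv ![c₀, c₁, c₂, c₃] (by
      apply Subtype.ext
      simpa [Fin.sum_univ_succ, add_assoc] using h)
    exact ⟨h1 0, h1 1, h1 2, h1 3⟩
  have hx0 : x ≠ 0 := by
    intro h
    have := (hrel 1 0 0 0 (by simp [h])).1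
    exact one_ne_zero this
  have hy0 : y ≠ 0 := by
    intro h
    have := (hrel 0 1 0 0 (by simp [h])).2.1
    exact one_ne_zero this
  have hb0 : b₃ ≠ 0 := by
    intro h
    have := (hrel 0 0 0 1 (by simp [h])).2.2.2
    exact one_ne_zero this
  have hxy : ∀ c : k, y ≠ c • x := by
    intro c h
    have := (hrel (-c) 1 0 0 (by simp [h])).2.1
    exact one_ne_zero this
  have hxb : ∀ c : k, b₃ ≠ c • x := by
    intro c h
    have := (hrel (-c) 0 0 1 (by simp [h])).2.2.2
    exact one_ne_zero this
  let w : Fin 2 ⊕ Fin 2 → homogeneousSubmodule (Fin n) k 1 :=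
    Sum.elim ![⟨x, hx⟩, ⟨b₃, hb₃⟩] ![⟨a₃, ha₃⟩, ⟨y, hy⟩ - ⟨b₃, hb₃⟩]
  have hw : LinearIndependent k w := by
    rw [Fintype.linearIndependent_iff]
    intro g hg
    have hg := congrArg Subtype.val hg
    have h1 := hrel (g (Sum.inl 0)) (g (Sum.inr 1)) (g (Sum.inr 0))
      (g (Sum.inl 1) - g (Sum.inr 1)) (by
        simp [w, Fintype.sum_sum_type, Fin.sum_univ_two] at hg
        rw [← hg, sub_smul, smul_sub]
        abel)
    obtain ⟨e1, e2, e3, e4⟩ := h1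
    rw [e2, sub_zero] at e4
    rintro (r | r) <;> fin_cases r <;> assumption
  obtain ⟨ι, hι, e, he1, he2, hcard⟩ := hb_exists_basis w hw
  have ex : x = e (Sum.inl 0) := by rw [he1]; rfl
  have eb : b₃ = e (Sum.inl 1) := by rw [he1]; rfl
  have ea : a₃ = e (Sum.inr (Sum.inl 0)) := by rw [he2]; rfl
  have ey : y - b₃ = e (Sum.inr (Sum.inl 1)) := by rw [he2]; rfl
  have hJ' : J = Ideal.span {x ^ 2, b₃ * x,
      (e (Sum.inr (Sum.inl 0)) : MvPolynomial (Fin n) k) * x +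
        b₃ * (b₃ + (e (Sum.inr (Sum.inl 1)) : MvPolynomial (Fin n) k))} := by
    rw [← ea, ← ey, add_sub_cancel, hJ, hq₃]
  refine ⟨?_, ?_, ?_, ?_⟩
  · rw [hJ, hq₃]
    apply le_antisymm
    · rw [Ideal.span_le]
      intro z hz
      simp only [Set.mem_insert_iff, Set.mem_singleton_iff] at hz
      rcases hz with rfl | rfl | rfl
      · rw [show x ^ 2 = (-x) * (-x) - 0 * y by ring]
        exact Ideal.subset_span (by simp)
      · rw [show b₃ * x = -(b₃ * (-x) - 0 * a₃) by ring]
        exact neg_mem (Ideal.subset_span (by simp))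
      · rw [show a₃ * x + b₃ * y = b₃ * y - (-x) * a₃ by ring]
        exact Ideal.subset_span (by simp)
    · rw [Ideal.span_le]
      intro z hz
      simp only [Set.mem_insert_iff, Set.mem_singleton_iff] at hz
      rcases hz with rfl | rfl | rfl
      · rw [show b₃ * y - (-x) * a₃ = a₃ * x + b₃ * y by ring]
        exact Ideal.subset_span (by simp)
      · rw [show b₃ * (-x) - 0 * a₃ = -(b₃ * x) by ring]
        exact neg_mem (Ideal.subset_span (by simp))
      · rw [show (-x) * (-x) - 0 * y = x ^ 2 by ring]
        exact Ideal.subset_span (by simp)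
  · rw [hJ, hq₃]
    exact hb_height hx hy hb₃ hx0 hy0 hb0 hxy hxb
  · exact hb_cm e _ _ x b₃ ex eb J hJ' hcard
  · have h := hb_series e _ _ x b₃ ex eb J hJ'
    rw [hcard] at h
    exact h
end

section
/- Let S be a polynomial ring over a field with linear forms x, y, a₂, b₃ such that ht(x, y, a₂, b₃) = 4. Then the ideal J = (xy, a₂x, b₃y) satisfies J = (x,y) ∩ (x,b₃) ∩ (y,a₂); in particular J is a height-two radical ideal with exactly three minimal primes, each generated by two linear forms. -/
open MvPolynomial

theorem idealHeight_eq_height {S : Type} [CommRing S] (I : Ideal S) :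
    idealHeight I = I.height := by
  unfold idealHeight
  apply le_antisymm
  · rw [Ideal.height_eq_inf_minimalPrimes]
    refine le_iInf₂ fun p hp => ?_
    have hpp : p.IsPrime := hp.isPrime
    refine (iInf₂_le (⟨p, hpp⟩ : PrimeSpectrum S) hp.1.2).trans ?_
    rw [← PrimeSpectrum.height_eq_orderHeight]
  · refine le_iInf₂ fun p hp => ?_
    rw [← PrimeSpectrum.height_eq_orderHeight]
    exact Ideal.height_mono hp

/-- An ideal generated by linear forms is prime. -/
theorem isPrime_span_linear {k : Type} [Field k] {n : ℕ}
    (A : Set (MvPolynomial (Fin n) k))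
    (hA : ∀ l ∈ A, l ∈ homogeneousSubmodule (Fin n) k 1) : (Ideal.span A).IsPrime := by
  set W : Submodule k (MvPolynomial (Fin n) k) := Submodule.span k A with hW
  obtain ⟨f, hf⟩ := LinearMap.exists_leftInverse_of_injective W.subtype W.ker_subtype
  have hfW : ∀ w (hw : w ∈ W), (f w : MvPolynomial (Fin n) k) = w := fun w hw => by
    have := LinearMap.congr_fun hf ⟨w, hw⟩
    simpa using congrArg Subtype.val this
  have hWI : ∀ w ∈ W, w ∈ Ideal.span A := fun w hw => by
    have : W ≤ (Ideal.span A).restrictScalars k :=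
      Submodule.span_le.mpr fun a ha => Ideal.subset_span ha
    exact this hw
  let φ : MvPolynomial (Fin n) k →ₐ[k] MvPolynomial (Fin n) k :=
    aeval fun i => X i - (f (X i) : MvPolynomial (Fin n) k)
  have hlin : ∀ l ∈ homogeneousSubmodule (Fin n) k 1,
      φ l = l - (f l : MvPolynomial (Fin n) k) := by
    intro l hl
    rw [homogeneousSubmodule_one_eq_span_X] at hl
    induction hl using Submodule.span_induction with
    | mem x hx => obtain ⟨i, rfl⟩ := hx; simp [φ]
    | zero => simp
    | add x y _ _ h1 h2 => simp only [map_add, h1, h2, Submodule.coe_add]; ring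
    | smul a x _ h => simp only [map_smul, h, Submodule.coe_smul, smul_sub]
  have hmod : ∀ g, g - φ g ∈ Ideal.span A := by
    intro g
    rw [← Ideal.Quotient.eq]
    have : (Ideal.Quotient.mkₐ k (Ideal.span A)) =
        (Ideal.Quotient.mkₐ k (Ideal.span A)).comp φ := by
      ext i
      simp only [AlgHom.comp_apply, Ideal.Quotient.mkₐ_eq_mk, φ, aeval_X]
      rw [Ideal.Quotient.eq]
      simpa using hWI _ (f (X i)).2
    exact DFunLike.congr_fun this g
  have hker : Ideal.span A = RingHom.ker φ := by
    apply le_antisymm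
    · rw [Ideal.span_le]
      intro a ha
      change φ a = 0
      rw [hlin a (hA a ha), hfW a (Submodule.subset_span ha), sub_self]
    · intro g hg
      have h := hmod g
      rw [show φ g = 0 from hg, sub_zero] at h
      exact h
  rw [hker]
  exact RingHom.ker_isPrime _

theorem height_span_le_card {S : Type} [CommRing S] [IsNoetherianRing S] (s : Finset S)
    (h : Ideal.span (s : Set S) ≠ ⊤) : (Ideal.span (s : Set S)).height ≤ s.card := by
  obtain ⟨p, hp⟩ := Ideal.nonempty_minimalPrimes h
  exact (Ideal.height_mono hp.1.2).trans
    (Ideal.height_le_card_of_mem_minimalPrimes_span_finset hp)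

theorem not_mem_of_height {S : Type} [CommRing S] [IsNoetherianRing S] {I : Ideal S}
    (hI : I.height = 4) (x a b c : S) (h : I = Ideal.span {x, a, b, c}) :
    x ∉ Ideal.span {a, b, c} := by
  classical
  intro hx
  have h2 : I = Ideal.span (({a, b, c} : Finset S) : Set S) := by
    rw [h, Ideal.span_insert, sup_eq_right.mpr]
    · simp
    · rwa [Ideal.span_singleton_le_iff_mem]
  have hne : Ideal.span (({a, b, c} : Finset S) : Set S) ≠ ⊤ := by
    intro ht
    rw [h2, ht, Ideal.height_top] at hI
    exact absurd hI (by decide)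
  have h3 := height_span_le_card _ hne
  rw [← h2, hI] at h3
  have h4 : ({a, b, c} : Finset S).card ≤ 3 := Finset.card_le_three
  have h5 : (4 : ℕ) ≤ ({a, b, c} : Finset S).card := by exact_mod_cast h3
  omega

theorem two_le_height_span_pair {k : Type} [Field k] {n : ℕ}
    (x y : MvPolynomial (Fin n) k)
    (hx : x ∈ homogeneousSubmodule (Fin n) k 1) (hy : y ∈ homogeneousSubmodule (Fin n) k 1)
    (hx0 : x ≠ 0) (hyx : y ∉ Ideal.span {x}) : 2 ≤ (Ideal.span {x, y}).height := by
  have p1 : (Ideal.span {x}).IsPrime := isPrime_span_linear {x} (by simpa using hx)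
  have p2 : (Ideal.span {x, y}).IsPrime := isPrime_span_linear {x, y} (by
    rintro l (rfl | rfl)
    exacts [hx, hy])
  have l1 : (⊥ : Ideal (MvPolynomial (Fin n) k)) < Ideal.span {x} := by
    rw [bot_lt_iff_ne_bot, Ne, Ideal.span_singleton_eq_bot]
    exact hx0
  have l2 : Ideal.span {x} < Ideal.span {x, y} := by
    refine lt_of_le_of_ne (Ideal.span_mono (by simp)) fun h => hyx ?_
    rw [h]
    exact Ideal.subset_span (by simp)
  have h1 := Ideal.height_add_one_le_of_lt_of_isPrime l1
  have h2 := Ideal.height_add_one_le_of_lt_of_isPrime l2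
  rw [Ideal.height_bot, zero_add] at h1
  calc (2 : ℕ∞) = 1 + 1 := by norm_num
    _ ≤ _ := by gcongr
    _ ≤ _ := h2

/-- If `x, y, a₂, b₃` are linear forms with `ht(x, y, a₂, b₃) = 4`, then
`J = (xy, a₂x, b₃y) = (x,y) ∩ (x,b₃) ∩ (y,a₂)`; in particular `J` is a height-two radical
ideal whose minimal primes are exactly the three ideals `(x,y)`, `(x,b₃)`, `(y,a₂)`, each a
prime generated by two linear forms. -/
theorem three_linear_primes_intersection {k : Type} [Field k] {n : ℕ}
    (x y a₂ b₃ : MvPolynomial (Fin n) k)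
    (hx : x ∈ homogeneousSubmodule (Fin n) k 1) (hy : y ∈ homogeneousSubmodule (Fin n) k 1)
    (ha₂ : a₂ ∈ homogeneousSubmodule (Fin n) k 1) (hb₃ : b₃ ∈ homogeneousSubmodule (Fin n) k 1)
    (hht : idealHeight (Ideal.span {x, y, a₂, b₃}) = 4)
    (J : Ideal (MvPolynomial (Fin n) k)) (hJ : J = Ideal.span {x * y, a₂ * x, b₃ * y}) :
    J = Ideal.span {x, y} ⊓ Ideal.span {x, b₃} ⊓ Ideal.span {y, a₂} ∧
    J.IsRadical ∧
    idealHeight J = 2 ∧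
    J.minimalPrimes = {Ideal.span {x, y}, Ideal.span {x, b₃}, Ideal.span {y, a₂}} ∧
    (Ideal.span {x, y}).IsPrime ∧ (Ideal.span {x, b₃}).IsPrime ∧
    (Ideal.span {y, a₂}).IsPrime := by
  classical
  rw [idealHeight_eq_height] at hht
  have nx := not_mem_of_height hht x y a₂ b₃ rfl
  have ny := not_mem_of_height hht y x a₂ b₃ (by congr 1; ext; simp; tauto)
  have na := not_mem_of_height hht a₂ x y b₃ (by congr 1; ext; simp; tauto)
  have nb := not_mem_of_height hht b₃ x y a₂ (by congr 1; ext; simp; tauto)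
  have pr : ∀ u v : MvPolynomial (Fin n) k, u ∈ homogeneousSubmodule (Fin n) k 1 →
      v ∈ homogeneousSubmodule (Fin n) k 1 → (Ideal.span {u, v}).IsPrime := by
    intro u v hu hv
    refine isPrime_span_linear {u, v} ?_
    rintro l (rfl | rfl)
    exacts [hu, hv]
  have P := pr x y hx hy
  have Q := pr x b₃ hx hb₃
  have R := pr y a₂ hy ha₂
  have sub : ∀ {s t : Set (MvPolynomial (Fin n) k)} {u}, u ∉ Ideal.span t → s ⊆ t →
      u ∉ Ideal.span s := fun h hst hu => h (Ideal.span_mono hst hu)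
  have xR : x ∉ Ideal.span {y, a₂} := sub nx (by intro z; simp; tauto)
  have yQ : y ∉ Ideal.span {x, b₃} := sub ny (by intro z; simp; tauto)
  have aP : a₂ ∉ Ideal.span {x, y} := sub na (by intro z; simp; tauto)
  have bP : b₃ ∉ Ideal.span {x, y} := sub nb (by intro z; simp; tauto)
  have hPQ : ¬ Ideal.span {x, y} ≤ Ideal.span {x, b₃} :=
    fun h => yQ (h (Ideal.subset_span (by simp)))
  have hPR : ¬ Ideal.span {x, y} ≤ Ideal.span {y, a₂} :=
    fun h => xR (h (Ideal.subset_span (by simp)))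
  have hQR : ¬ Ideal.span {x, b₃} ≤ Ideal.span {y, a₂} :=
    fun h => xR (h (Ideal.subset_span (by simp)))
  have hRQ : ¬ Ideal.span {y, a₂} ≤ Ideal.span {x, b₃} :=
    fun h => yQ (h (Ideal.subset_span (by simp)))
  have hQP : ¬ Ideal.span {x, b₃} ≤ Ideal.span {x, y} :=
    fun h => bP (h (Ideal.subset_span (by simp)))
  have hRP : ¬ Ideal.span {y, a₂} ≤ Ideal.span {x, y} :=
    fun h => aP (h (Ideal.subset_span (by simp)))
  have hJeq : J = Ideal.span {x, y} ⊓ Ideal.span {x, b₃} ⊓ Ideal.span {y, a₂} := by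
    apply le_antisymm
    · rw [hJ, Ideal.span_le]
      rintro l (rfl | rfl | rfl)
      · refine ⟨⟨?_, ?_⟩, ?_⟩ <;> refine Ideal.mem_span_pair.mpr ?_
        exacts [⟨y, 0, by ring⟩, ⟨y, 0, by ring⟩, ⟨x, 0, by ring⟩]
      · refine ⟨⟨?_, ?_⟩, ?_⟩ <;> refine Ideal.mem_span_pair.mpr ?_
        exacts [⟨a₂, 0, by ring⟩, ⟨a₂, 0, by ring⟩, ⟨0, x, by ring⟩]
      · refine ⟨⟨?_, ?_⟩, ?_⟩ <;> refine Ideal.mem_span_pair.mpr ?_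
        exacts [⟨0, b₃, by ring⟩, ⟨0, y, by ring⟩, ⟨b₃, 0, by ring⟩]
    · rintro g ⟨⟨g1, g2⟩, g3⟩
      obtain ⟨α, β, rfl⟩ := Ideal.mem_span_pair.mp g1
      have e1 : β * y ∈ Ideal.span {x, b₃} := by
        refine (Ideal.add_mem_iff_right _ ?_).mp g2
        exact Ideal.mul_mem_left _ _ (Ideal.subset_span (by simp))
      obtain ⟨γ, δ, rfl⟩ := Ideal.mem_span_pair.mp ((Q.mem_or_mem e1).resolve_right yQ)
      have e2 : (α + γ * y) * x ∈ Ideal.span {y, a₂} := by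
        have : (α + γ * y) * x =
            (α * x + (γ * x + δ * b₃) * y) - δ * b₃ * y := by ring
        rw [this]
        exact Ideal.sub_mem _ g3 (Ideal.mul_mem_left _ _ (Ideal.subset_span (by simp)))
      obtain ⟨ε, ζ, he⟩ := Ideal.mem_span_pair.mp ((R.mem_or_mem e2).resolve_right xR)
      have : α * x + (γ * x + δ * b₃) * y =
          ε * (x * y) + ζ * (a₂ * x) + δ * (b₃ * y) := by
        linear_combination (-x) * he
      rw [this, hJ]
      refine Ideal.add_mem _ (Ideal.add_mem _ ?_ ?_) ?_ <;>
        exact Ideal.mul_mem_left _ _ (Ideal.subset_span (by simp))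
  have key : ∀ p : Ideal (MvPolynomial (Fin n) k), p.IsPrime → J ≤ p →
      Ideal.span {x, y} ≤ p ∨ Ideal.span {x, b₃} ≤ p ∨ Ideal.span {y, a₂} ≤ p := by
    intro p hp hle
    rw [hJeq, hp.inf_le, hp.inf_le] at hle
    tauto
  have JP : J ≤ Ideal.span {x, y} := hJeq ▸ inf_le_left.trans inf_le_left
  have JQ : J ≤ Ideal.span {x, b₃} := hJeq ▸ inf_le_left.trans inf_le_right
  have JR : J ≤ Ideal.span {y, a₂} := hJeq ▸ inf_le_right
  have x0 : x ≠ 0 := fun h => xR (h ▸ Ideal.zero_mem _)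
  have y0 : y ≠ 0 := fun h => yQ (h ▸ Ideal.zero_mem _)
  refine ⟨hJeq, ?_, ?_, ?_, P, Q, R⟩
  · rw [hJeq]
    exact (P.isRadical.inf Q.isRadical).inf R.isRadical
  · rw [idealHeight_eq_height]
    apply le_antisymm
    · refine (Ideal.height_mono JP).trans ?_
      have h := height_span_le_card ({x, y} : Finset (MvPolynomial (Fin n) k))
        (by simpa using P.ne_top)
      have hc : ({x, y} : Finset (MvPolynomial (Fin n) k)).card ≤ 2 := Finset.card_le_two
      simp only [Finset.coe_insert, Finset.coe_singleton] at h
      exact h.trans (by exact_mod_cast hc)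
    · rw [Ideal.height_eq_inf_minimalPrimes]
      refine le_iInf₂ fun p hp => ?_
      rcases key p hp.isPrime hp.1.2 with h | h | h <;> refine le_trans ?_ (Ideal.height_mono h)
      · exact two_le_height_span_pair x y hx hy x0 (sub ny (by intro z; simp; tauto))
      · exact two_le_height_span_pair x b₃ hx hb₃ x0 (sub nb (by intro z; simp; tauto))
      · exact two_le_height_span_pair y a₂ hy ha₂ y0 (sub na (by intro z; simp; tauto))
  · ext p
    simp only [Set.mem_insert_iff, Set.mem_singleton_iff]
    constructor
    · intro hp
      rcases key p hp.isPrime hp.1.2 with h | h | h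
      · exact Or.inl (le_antisymm (hp.2 ⟨P, JP⟩ h) h)
      · exact Or.inr (Or.inl (le_antisymm (hp.2 ⟨Q, JQ⟩ h) h))
      · exact Or.inr (Or.inr (le_antisymm (hp.2 ⟨R, JR⟩ h) h))
    · rintro (rfl | rfl | rfl)
      · refine ⟨⟨P, JP⟩, fun q hq hle => ?_⟩
        rcases key q hq.1 hq.2 with h | h | h
        exacts [h, absurd (h.trans hle) hQP, absurd (h.trans hle) hRP]
      · refine ⟨⟨Q, JQ⟩, fun q hq hle => ?_⟩
        rcases key q hq.1 hq.2 with h | h | h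
        exacts [absurd (h.trans hle) hPQ, h, absurd (h.trans hle) hRQ]
      · refine ⟨⟨R, JR⟩, fun q hq hle => ?_⟩
        rcases key q hq.1 hq.2 with h | h | h
        exacts [absurd (h.trans hle) hPR, absurd (h.trans hle) hQR, h]
end

section
/- Let k be a field and R = k[x, y, a, b]/(bx, xy, ax − by, x² − y²). Then R is isomorphic as a graded k-algebra to the symmetric algebra Sym_{R'}(M), where R' = k[x,y]/(x²−y², xy) and M is the cokernel over R' of the matrix A = [[x, 0], [−y, x]]. -/
open MvPolynomial

noncomputable section

variable (k : Type) [Field k]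

/-- The defining ideal `(bx, xy, ax − by, x² − y²)` of `R`, where
`x = X 0`, `y = X 1`, `a = X 2`, `b = X 3` in `k[x,y,a,b]`. -/
def rIdeal : Ideal (MvPolynomial (Fin 4) k) :=
  Ideal.span {X 3 * X 0, X 0 * X 1, X 2 * X 0 - X 3 * X 1, X 0 ^ 2 - X 1 ^ 2}

/-- The ring `R = k[x,y,a,b]/(bx, xy, ax − by, x² − y²)`. -/
def Rring := MvPolynomial (Fin 4) k ⧸ rIdeal k

instance : CommRing (Rring k) := by unfold Rring; infer_instance
instance : Algebra k (Rring k) := by unfold Rring; infer_instance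

/-- `R' = k[x,y]/(x² − y², xy)` with `x = X 0`, `y = X 1`. -/
def Rprime := MvPolynomial (Fin 2) k ⧸
  (Ideal.span {(X 0 : MvPolynomial (Fin 2) k) ^ 2 - X 1 ^ 2, X 0 * X 1})

instance : CommRing (Rprime k) := by unfold Rprime; infer_instance
instance : Algebra k (Rprime k) := by unfold Rprime; infer_instance

/-- The image of `x` in `R'`. -/
def xR : Rprime k := Ideal.Quotient.mk _ (X 0)
/-- The image of `y` in `R'`. -/
def yR : Rprime k := Ideal.Quotient.mk _ (X 1)

/-- The matrix `A = [[x, 0], [−y, x]]` over `R'`. -/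
def matA : Matrix (Fin 2) (Fin 2) (Rprime k) := !![xR k, 0; -yR k, xR k]

/-- `M = coker A`, the `R'`-module presented by the matrix `A`. -/
def Mmod := (Fin 2 → Rprime k) ⧸ LinearMap.range (matA k).mulVecLin

instance : AddCommGroup (Mmod k) := by unfold Mmod; infer_instance
instance : Module (Rprime k) (Mmod k) := by unfold Mmod; infer_instance

/-- The two standard generators of `M = coker A`. -/
def Mgen (i : Fin 2) : Mmod k :=
  Submodule.Quotient.mk (Pi.single i (1 : Rprime k))

/-- The defining relation of the symmetric algebra of `M` over `R'`. -/
inductive SymRel :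
    TensorAlgebra (Rprime k) (Mmod k) → TensorAlgebra (Rprime k) (Mmod k) → Prop
  | comm (m n : Mmod k) :
      SymRel (TensorAlgebra.ι (Rprime k) m * TensorAlgebra.ι (Rprime k) n)
        (TensorAlgebra.ι (Rprime k) n * TensorAlgebra.ι (Rprime k) m)

/-- The symmetric algebra `Sym_{R'}(M)`: the tensor algebra modulo commutativity of the
embedded module elements. -/
def SymMAlg := RingQuot (SymRel k)

instance : Ring (SymMAlg k) := by unfold SymMAlg; infer_instance
instance : Algebra (Rprime k) (SymMAlg k) := by unfold SymMAlg; infer_instance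

section Helpers

/-- Quotient map onto `R`. -/
def prR : MvPolynomial (Fin 4) k →+* Rring k := Ideal.Quotient.mk (rIdeal k)

/-- Quotient map onto the base ring. -/
def prR' : MvPolynomial (Fin 2) k →+* Rprime k := Ideal.Quotient.mk _

/-- Quotient map onto `M`. -/
def prM : (Fin 2 → Rprime k) →ₗ[Rprime k] Mmod k := Submodule.mkQ _

/-- Quotient map onto `Sym M`. -/
def prS : TensorAlgebra (Rprime k) (Mmod k) →ₐ[Rprime k] SymMAlg k :=
  RingQuot.mkAlgHom (Rprime k) (SymRel k)

/-- The map `M → Sym M`. -/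
def iotaS : Mmod k →ₗ[Rprime k] SymMAlg k :=
  (prS k).toLinearMap ∘ₗ TensorAlgebra.ι (Rprime k)

theorem prR_surj : Function.Surjective (prR k) := Ideal.Quotient.mk_surjective
theorem prR'_surj : Function.Surjective (prR' k) := Ideal.Quotient.mk_surjective
theorem prM_surj : Function.Surjective (prM k) := Submodule.mkQ_surjective _
theorem prS_surj : Function.Surjective (prS k) := RingQuot.mkAlgHom_surjective _ _

theorem SymMAlg_induction {P : SymMAlg k → Prop}
    (h1 : ∀ r, P (algebraMap (Rprime k) (SymMAlg k) r)) (h2 : ∀ m, P (iotaS k m))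
    (h3 : ∀ a b, P a → P b → P (a * b))
    (h4 : ∀ a b, P a → P b → P (a + b)) (a : SymMAlg k) : P a := by
  rcases prS_surj k a with ⟨a, rfl⟩
  induction a using TensorAlgebra.induction with
  | algebraMap r => rw [AlgHom.commutes]; exact h1 r
  | ι x => exact h2 x
  | mul x y hx hy => rw [map_mul]; exact h3 _ _ hx hy
  | add x y hx hy => rw [map_add]; exact h4 _ _ hx hy

theorem iotaS_comm (m n : Mmod k) : iotaS k m * iotaS k n = iotaS k n * iotaS k m := by
  have h := RingQuot.mkAlgHom_rel (Rprime k) (SymRel.comm (k := k) m n)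
  have h' : prS k (TensorAlgebra.ι (Rprime k) m * TensorAlgebra.ι (Rprime k) n) =
      prS k (TensorAlgebra.ι (Rprime k) n * TensorAlgebra.ι (Rprime k) m) := h
  rw [map_mul, map_mul] at h'
  exact h'

theorem SymMAlg_comm (a b : SymMAlg k) : a * b = b * a := by
  change Commute a b
  induction b using SymMAlg_induction with
  | h1 r => exact Algebra.commute_algebraMap_right _ _
  | h2 x => induction a using SymMAlg_induction with
    | h1 r => exact Algebra.commute_algebraMap_left _ _
    | h2 y => exact iotaS_comm k y x
    | h3 a b ha hb => exact ha.mul_left hb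
    | h4 a b ha hb => exact ha.add_left hb
  | h3 b c hb hc => exact hb.mul_right hc
  | h4 b c hb hc => exact hb.add_right hc

/-- `Sym M` is commutative. -/
@[reducible] def instCommRingSymMAlg : CommRing (SymMAlg k) :=
  { (inferInstance : Ring (SymMAlg k)) with mul_comm := SymMAlg_comm k }

attribute [local instance] instCommRingSymMAlg

/-- The polynomial map onto `Sym M`. -/
def fwd0 : MvPolynomial (Fin 4) k →+* SymMAlg k :=
  eval₂Hom ((algebraMap (Rprime k) (SymMAlg k)).comp (algebraMap k (Rprime k)))
    ![algebraMap (Rprime k) (SymMAlg k) (xR k), algebraMap (Rprime k) (SymMAlg k) (yR k),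
      iotaS k (Mgen k 0), iotaS k (Mgen k 1)]

theorem xy_rel : xR k * yR k = 0 := by
  have : prR' k (X 0 * X 1) = 0 :=
    Ideal.Quotient.eq_zero_iff_mem.2 (Ideal.subset_span (by simp))
  rw [map_mul] at this
  exact this

theorem xx_rel : xR k ^ 2 - yR k ^ 2 = 0 := by
  have : prR' k (X 0 ^ 2 - X 1 ^ 2) = 0 :=
    Ideal.Quotient.eq_zero_iff_mem.2 (Ideal.subset_span (by simp))
  rw [map_sub, map_pow, map_pow] at this
  exact this

theorem prM_eq (v : Fin 2 → Rprime k) : prM k v = v 0 • Mgen k 0 + v 1 • Mgen k 1 := by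
  have h : v = v 0 • Pi.single 0 1 + v 1 • Pi.single 1 1 := by
    ext i; fin_cases i <;> simp
  conv_lhs => rw [h]
  rw [map_add, map_smul, map_smul]
  rfl

theorem prM_rel (v : Fin 2 → Rprime k) : prM k ((matA k).mulVec v) = 0 :=
  (Submodule.Quotient.mk_eq_zero _).2 ⟨v, rfl⟩

theorem rel_ab : xR k • Mgen k 0 - yR k • Mgen k 1 = 0 := by
  have h := prM_rel k ![1, 0]
  rw [prM_eq] at h
  simpa [matA, Matrix.mulVec, dotProduct, sub_eq_add_neg] using h

theorem rel_b : xR k • Mgen k 1 = 0 := by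
  have h := prM_rel k ![0, 1]
  rw [prM_eq] at h
  simpa [matA, Matrix.mulVec, dotProduct] using h

theorem fwd0_zero (p : MvPolynomial (Fin 4) k) (hp : p ∈ rIdeal k) : fwd0 k p = 0 := by
  have : rIdeal k ≤ RingHom.ker (fwd0 k) := by
    rw [rIdeal, Ideal.span_le]
    rintro q (rfl | rfl | rfl | rfl)
    · have := congrArg (iotaS k) (rel_b k)
      rw [map_smul, map_zero, Algebra.smul_def, mul_comm] at this
      simpa [fwd0, RingHom.mem_ker] using this
    · have := congrArg (algebraMap (Rprime k) (SymMAlg k)) (xy_rel k)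
      rw [map_mul, map_zero] at this
      simpa [fwd0, RingHom.mem_ker] using this
    · have := congrArg (iotaS k) (rel_ab k)
      rw [map_sub, map_smul, map_smul, map_zero, Algebra.smul_def, Algebra.smul_def, mul_comm,
        mul_comm (algebraMap _ _ (yR k))] at this
      simpa [fwd0, RingHom.mem_ker] using this
    · have := congrArg (algebraMap (Rprime k) (SymMAlg k)) (xx_rel k)
      rw [map_sub, map_pow, map_pow, map_zero] at this
      simpa [fwd0, RingHom.mem_ker] using this
  exact this hp

/-- The map `R → Sym M`. -/
def fwd : Rring k →+* SymMAlg k := Ideal.Quotient.lift (rIdeal k) (fwd0 k) (fwd0_zero k)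

theorem fwd_prR (p : MvPolynomial (Fin 4) k) : fwd k (prR k p) = fwd0 k p := rfl

theorem prR_zero {p : MvPolynomial (Fin 4) k}
    (hp : p ∈ ({X 3 * X 0, X 0 * X 1, X 2 * X 0 - X 3 * X 1, X 0 ^ 2 - X 1 ^ 2} :
      Set (MvPolynomial (Fin 4) k))) : prR k p = 0 :=
  Ideal.Quotient.eq_zero_iff_mem.2 (Ideal.subset_span hp)

/-- The polynomial map `k[x,y] → R`. -/
def jmap0 : MvPolynomial (Fin 2) k →+* Rring k :=
  eval₂Hom ((prR k).comp C) ![prR k (X 0), prR k (X 1)]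

theorem jmap0_zero (p : MvPolynomial (Fin 2) k)
    (hp : p ∈ Ideal.span {(X 0 : MvPolynomial (Fin 2) k) ^ 2 - X 1 ^ 2, X 0 * X 1}) :
    jmap0 k p = 0 := by
  have : Ideal.span {(X 0 : MvPolynomial (Fin 2) k) ^ 2 - X 1 ^ 2, X 0 * X 1} ≤
      RingHom.ker (jmap0 k) := by
    rw [Ideal.span_le]
    rintro q (rfl | rfl)
    · have := prR_zero k (p := X 0 ^ 2 - X 1 ^ 2) (by simp)
      rw [map_sub, map_pow, map_pow] at this
      simpa [jmap0, RingHom.mem_ker] using this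
    · have := prR_zero k (p := X 0 * X 1) (by simp)
      rw [map_mul] at this
      simpa [jmap0, RingHom.mem_ker] using this
  exact this hp

/-- The map from the base ring. -/
def jmap : Rprime k →+* Rring k := Ideal.Quotient.lift _ (jmap0 k) (jmap0_zero k)

theorem jmap_prR' (p : MvPolynomial (Fin 2) k) : jmap k (prR' k p) = jmap0 k p := rfl

theorem jmap_x : jmap k (xR k) = prR k (X 0) := by
  change jmap k (prR' k (X 0)) = _
  simp [jmap_prR', jmap0]

theorem jmap_y : jmap k (yR k) = prR k (X 1) := by
  change jmap k (prR' k (X 1)) = _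
  simp [jmap_prR', jmap0]

/-- The algebra structure on the ring over the base ring. -/
@[reducible] def instAlgRpR : Algebra (Rprime k) (Rring k) := (jmap k).toAlgebra

attribute [local instance] instAlgRpR

theorem algMap_eq : algebraMap (Rprime k) (Rring k) = jmap k := rfl

/-- The map from the free module. -/
def hlin0 : (Fin 2 → Rprime k) →ₗ[Rprime k] Rring k :=
  (LinearMap.proj 0).smulRight (prR k (X 2)) + (LinearMap.proj 1).smulRight (prR k (X 3))

theorem hlin0_apply (v : Fin 2 → Rprime k) :
    hlin0 k v = jmap k (v 0) * prR k (X 2) + jmap k (v 1) * prR k (X 3) := rfl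

theorem hlin0_zero : LinearMap.range (matA k).mulVecLin ≤ LinearMap.ker (hlin0 k) := by
  rintro _ ⟨v, rfl⟩
  have h1 := prR_zero k (p := X 3 * X 0) (by simp)
  have h2 := prR_zero k (p := X 2 * X 0 - X 3 * X 1) (by simp)
  rw [map_mul] at h1
  rw [map_sub, map_mul, map_mul] at h2
  rw [LinearMap.mem_ker, hlin0_apply]
  simp only [matA, Matrix.mulVecLin_apply, Matrix.mulVec, dotProduct, Fin.sum_univ_two,
    Matrix.of_apply, Matrix.cons_val_zero, Matrix.cons_val_one, map_add, map_mul, map_neg,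
    map_zero, jmap_x, jmap_y]
  linear_combination jmap k (v 0) * h2 + jmap k (v 1) * h1

theorem hlin0_congr {v w : Fin 2 → Rprime k} (h : prM k v = prM k w) :
    hlin0 k v = hlin0 k w := by
  have h1 : v - w ∈ LinearMap.range (matA k).mulVecLin := (Submodule.Quotient.eq _).1 h
  have h2 : hlin0 k (v - w) = 0 := hlin0_zero k h1
  have h3 : hlin0 k v = hlin0 k (v - w) + hlin0 k w := by rw [← map_add, sub_add_cancel]
  rw [h3, h2, zero_add]

/-- The map `M → R`. -/
def hlin : Mmod k →ₗ[Rprime k] Rring k where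
  toFun m := hlin0 k (Function.surjInv (prM_surj k) m)
  map_add' m n := by
    rw [← map_add]
    apply hlin0_congr
    rw [map_add]
    simp only [Function.surjInv_eq]
  map_smul' r m := by
    rw [RingHom.id_apply, ← map_smul]
    apply hlin0_congr
    rw [map_smul]
    simp only [Function.surjInv_eq]

theorem hlin_prM (v : Fin 2 → Rprime k) : hlin k (prM k v) = hlin0 k v :=
  hlin0_congr k (Function.surjInv_eq (prM_surj k) _)

theorem hlin_gen0 : hlin k (Mgen k 0) = prR k (X 2) := by
  change hlin k (prM k (Pi.single 0 1)) = _
  rw [hlin_prM]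
  simp [hlin0_apply]

theorem hlin_gen1 : hlin k (Mgen k 1) = prR k (X 3) := by
  change hlin k (prM k (Pi.single 1 1)) = _
  rw [hlin_prM]
  simp [hlin0_apply]

/-- The map `Sym M → R`. -/
def bwd : SymMAlg k →ₐ[Rprime k] Rring k :=
  RingQuot.liftAlgHom (Rprime k) ⟨TensorAlgebra.lift (Rprime k) (hlin k), by
    rintro _ _ ⟨m, n⟩
    rw [map_mul, map_mul, mul_comm]⟩

theorem bwd_iota (m : Mmod k) : bwd k (iotaS k m) = hlin k m := by
  have h : bwd k (iotaS k m) = TensorAlgebra.lift (Rprime k) (hlin k) (TensorAlgebra.ι _ m) :=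
    RingQuot.liftAlgHom_mkAlgHom_apply _ _ _ _
  rw [h, TensorAlgebra.lift_ι_apply]

theorem bwd_alg (r : Rprime k) : bwd k (algebraMap _ _ r) = jmap k r := (bwd k).commutes r

theorem jmap_c (c : k) : jmap k (algebraMap k (Rprime k) c) = prR k (C c) := by
  change jmap k (prR' k (C c)) = _
  simp [jmap_prR', jmap0]

theorem bwd_fwd (r : Rring k) : bwd k (fwd k r) = r := by
  obtain ⟨p, rfl⟩ := prR_surj k r
  rw [fwd_prR]
  have h : ((bwd k : SymMAlg k →+* Rring k)).comp (fwd0 k) = prR k := by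
    apply MvPolynomial.ringHom_ext
    · intro c
      simp [fwd0, algMap_eq, jmap_c]
    · intro i
      fin_cases i <;> simp [fwd0, algMap_eq, bwd_iota, jmap_x, jmap_y, hlin_gen0, hlin_gen1]
  exact congrArg (fun f => f p) h

theorem fwd_jmap (r : Rprime k) : fwd k (jmap k r) = algebraMap _ _ r := by
  obtain ⟨p, rfl⟩ := prR'_surj k r
  rw [jmap_prR']
  have h : (fwd k).comp (jmap0 k) = (algebraMap (Rprime k) (SymMAlg k)).comp (prR' k) := by
    apply MvPolynomial.ringHom_ext
    · intro c
      simp only [jmap0, RingHom.comp_apply, coe_eval₂Hom, eval₂_C, fwd_prR, fwd0]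
      rfl
    · intro i
      fin_cases i <;> simp [jmap0, fwd_prR, fwd0] <;> rfl
  exact congrArg (fun f => f p) h

theorem fwd_bwd (s : SymMAlg k) : fwd k (bwd k s) = s := by
  induction s using SymMAlg_induction with
  | h1 r => rw [bwd_alg, fwd_jmap]
  | h2 m =>
    obtain ⟨v, rfl⟩ := prM_surj k m
    rw [bwd_iota, prM_eq]
    simp only [map_add, map_smul, hlin_gen0, hlin_gen1, Algebra.smul_def, algMap_eq, map_mul,
      fwd_jmap, fwd_prR]
    simp [fwd0]
  | h3 a b ha hb => rw [map_mul, map_mul, ha, hb]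
  | h4 a b ha hb => rw [map_add, map_add, ha, hb]

theorem fwd_map_mul (a b : Rring k) : fwd k (a * b) = fwd k a * fwd k b := map_mul _ _ _

theorem fwd_map_add (a b : Rring k) : fwd k (a + b) = fwd k a + fwd k b := map_add _ _ _

/-- The underlying function of the inverse. -/
def bwdFun (s : SymMAlg k) : Rring k := bwd k s

theorem fwd_c (c : k) : fwd0 k (C c) =
    algebraMap (Rprime k) (SymMAlg k) (algebraMap k (Rprime k) c) := by
  simp [fwd0]

theorem fwd_x : fwd0 k (X 0) = algebraMap (Rprime k) (SymMAlg k) (xR k) := by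
  simp [fwd0]

theorem fwd_y : fwd0 k (X 1) = algebraMap (Rprime k) (SymMAlg k) (yR k) := by
  simp [fwd0]

theorem fwd_a : fwd0 k (X 2) = iotaS k (Mgen k 0) := by
  simp [fwd0]

theorem fwd_b : fwd0 k (X 3) = iotaS k (Mgen k 1) := by
  simp [fwd0]

end Helpers

/-- The isomorphism `R ≃ Sym M`. -/
def theEquiv : Rring k ≃+* SymMAlg k where
  toFun r := fwd k r
  invFun := bwdFun k
  left_inv := bwd_fwd k
  right_inv := fwd_bwd k
  map_mul' := fwd_map_mul k
  map_add' := fwd_map_add k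

/-- `R = k[x,y,a,b]/(bx, xy, ax − by, x² − y²)` is isomorphic, as a graded `k`-algebra, to
the symmetric algebra `Sym_{R'}(M)` where `R' = k[x,y]/(x²−y², xy)` and `M = coker A`:
there is a ring isomorphism commuting with the `k`-algebra structures which sends `x, y` to
the corresponding scalars of `R'` and `a, b` to the two generators of `M`. -/
theorem Rring_iso_symmetricAlgebra :
    ∃ e : Rring k ≃+* SymMAlg k,
      (∀ c : k, e (algebraMap k (Rring k) c) =
        algebraMap (Rprime k) (SymMAlg k) (algebraMap k (Rprime k) c)) ∧
      e (Ideal.Quotient.mk (rIdeal k) (X 0)) = algebraMap (Rprime k) (SymMAlg k) (xR k) ∧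
      e (Ideal.Quotient.mk (rIdeal k) (X 1)) = algebraMap (Rprime k) (SymMAlg k) (yR k) ∧
      e (Ideal.Quotient.mk (rIdeal k) (X 2)) =
        RingQuot.mkAlgHom (Rprime k) (SymRel k) (TensorAlgebra.ι (Rprime k) (Mgen k 0)) ∧
      e (Ideal.Quotient.mk (rIdeal k) (X 3)) =
        RingQuot.mkAlgHom (Rprime k) (SymRel k) (TensorAlgebra.ι (Rprime k) (Mgen k 1)) := by
  exact ⟨theEquiv k, fwd_c k, fwd_x k, fwd_y k, fwd_a k, fwd_b k⟩

end
end
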